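/- Let μ be a singular cardinal of cofinality ω and λ = μ^{ℵ₀}. Then the completion of the quotient Boolean algebra P(μ)/[μ]^{<μ} contains a complete subalgebra isomorphic to the completion of the collapse poset Col(ω₁, λ). Consequently, forcing with P(μ)/[μ]^{<μ} collapses μ^{ℵ₀} to ℵ₁. -/

import Mathlib

open Cardinal Set

noncomputable section

/-- Cardinality of a set of ordinals. -/
def scard (s : Set Ordinal.{0}) : Cardinal.{1} := Cardinal.mk s

/-- The set of accumulation points of a set of ordinals `p`:
ordinals `α` such that `p ∩ α` is nonempty and unbounded in `α`. -/
def accSet (p : Set Ordinal.{0}) : Set Ordinal.{0} :=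
  {α | (p ∩ Set.Iio α).Nonempty ∧ α = sSup (p ∩ Set.Iio α)}

/-- A set of ordinals is closed iff it contains all of its accumulation
points below its supremum. -/
def IsClosedCond (q : Set Ordinal.{0}) : Prop :=
  accSet q ∩ Set.Iio (sSup q) ⊆ q

/-- Order type of a set of ordinals. -/
def otp (s : Set Ordinal.{0}) : Ordinal.{1} :=
  Ordinal.type ((· < ·) : s → s → Prop)

/-- Membership in the poset `P`: subsets of `μ` of cardinality `μ`. -/
def InP (μ : Cardinal.{0}) (p : Set Ordinal.{0}) : Prop :=
  p ⊆ Set.Iio μ.ord ∧ scard p = Cardinal.lift.{1,0} μ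

/-- The almost-inclusion ordering: `p₁ ≤ p₂` iff `|p₁ \ p₂| < μ`. -/
def condLe (μ : Cardinal.{0}) (p₁ p₂ : Set Ordinal.{0}) : Prop :=
  scard (p₁ \ p₂) < Cardinal.lift.{1,0} μ

/-- Membership in the poset `Q`: closed subsets of `μ` of cardinality `μ`. -/
def InQ (μ : Cardinal.{0}) (q : Set Ordinal.{0}) : Prop :=
  InP μ q ∧ IsClosedCond q

/-- The interval `[μₙ, μₙ₊₁)`. -/
def interval (μseq : ℕ → Cardinal.{0}) (n : ℕ) : Set Ordinal.{0} :=
  Set.Ico ((μseq n).ord) ((μseq (n+1)).ord)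

/-- `a(q) = {n : q ∩ [μₙ, μₙ₊₁) ≠ ∅}`. -/
def aSet (μseq : ℕ → Cardinal.{0}) (q : Set Ordinal.{0}) : Set ℕ :=
  {n | (q ∩ interval μseq n).Nonempty}

/-- Normality: letting `⟨mₙ⟩` enumerate `a(q)` increasingly,
`otp (q ∩ [μ_{mₙ}, μ_{mₙ+1})) = μₙ + 1`. -/
def IsNormalCond (μseq : ℕ → Cardinal.{0}) (q : Set Ordinal.{0}) : Prop :=
  ∃ m : ℕ → ℕ, StrictMono m ∧ Set.range m = aSet μseq q ∧
    ∀ n, otp (q ∩ interval μseq (m n)) = Ordinal.lift.{1,0} ((μseq n).ord + 1)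

/-- `χ⁺_q(n) = sup (q ∩ [μₙ, μₙ₊₁))`. -/
def chiP (μseq : ℕ → Cardinal.{0}) (q : Set Ordinal.{0}) (n : ℕ) : Ordinal.{0} :=
  sSup (q ∩ interval μseq n)

/-- `χ⁻_q(n) = min (q ∩ [μₙ, μₙ₊₁))`. -/
def chiM (μseq : ℕ → Cardinal.{0}) (q : Set Ordinal.{0}) (n : ℕ) : Ordinal.{0} :=
  sInf (q ∩ interval μseq n)

/-- `μₙ` is a strictly increasing sequence of regular cardinals with supremum `μ`. -/
def GoodSeq (μ : Cardinal.{0}) (μseq : ℕ → Cardinal.{0}) : Prop :=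
  StrictMono μseq ∧ (∀ n, (μseq n).IsRegular) ∧ μ = ⨆ n, μseq n

/-- The Lévy collapse `Col(ω₁, λ)`: functions from a countable ordinal into `λ`,
coded as `Option`-valued functions on the ordinals. -/
def Col (lam : Cardinal.{0}) : Type 1 :=
  {f : Ordinal.{0} → Option Ordinal.{0} //
    ∃ i, i < (Cardinal.aleph 1).ord ∧ (∀ j, (f j).isSome ↔ j < i) ∧
      ∀ j y, f j = some y → y < lam.ord}

/-- `Col(ω₁, λ)` ordered by reverse inclusion. -/
instance ColOrder (lam : Cardinal.{0}) : Preorder (Col lam) where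
  le f g := ∀ j y, g.1 j = some y → f.1 j = some y
  le_refl f := fun _ _ h => h
  le_trans f g h hfg hgh := fun j y hy => hfg j y (hgh j y hy)


theorem embed_lemma {R : Type*} [Preorder R] {B C : Type*} [CompleteBooleanAlgebra B]
    [CompleteBooleanAlgebra C] (e' : R → C)
    (he'₁ : ∀ f, e' f ≠ ⊥)
    (he'₂ : ∀ f g, f ≤ g → e' f ≤ e' g)
    (he'₃ : ∀ f g, (∃ r, r ≤ f ∧ r ≤ g) ↔ e' f ⊓ e' g ≠ ⊥)
    (he'₄ : ∀ c : C, c ≠ ⊥ → ∃ f, e' f ≤ c)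
    (ι : R → B)
    (ι_ne : ∀ f, ι f ≠ ⊥)
    (ι_disj : ∀ f g, (¬ ∃ r, r ≤ f ∧ r ≤ g) → ι f ⊓ ι g = ⊥)
    (ι_dense : ∀ Δ : Set R, (∀ f g, f ≤ g → g ∈ Δ → f ∈ Δ) → (∀ f, ∃ g, g ≤ f ∧ g ∈ Δ) →
      sSup (ι '' Δ) = ⊤) :
    ∃ F : C → B, Function.Injective F ∧ F ⊥ = ⊥ ∧ F ⊤ = ⊤ ∧
      (∀ a b, F (a ⊓ b) = F a ⊓ F b) ∧ (∀ a b, F (a ⊔ b) = F a ⊔ F b) ∧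
      (∀ a, F aᶜ = (F a)ᶜ) ∧
      (∀ S : Set C, F (sSup S) = sSup (F '' S)) ∧
      (∀ S : Set C, F (sInf S) = sInf (F '' S)) := by
  have refine_ : ∀ f c, e' f ⊓ c ≠ ⊥ → ∃ r, r ≤ f ∧ e' r ≤ c := by
    intro f c h
    obtain ⟨g, hg⟩ := he'₄ _ h
    have h1 : e' g ⊓ e' f ≠ ⊥ := by
      rw [inf_eq_left.2 (hg.trans inf_le_left)]; exact he'₁ g
    obtain ⟨r, hr1, hr2⟩ := (he'₃ g f).2 h1
    exact ⟨r, hr2, (he'₂ _ _ hr1).trans (hg.trans inf_le_right)⟩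
  let F : C → B := fun c => sSup (ι '' {f | e' f ≤ c})
  have F_mono : ∀ a b, a ≤ b → F a ≤ F b := by
    intro a b h
    apply sSup_le_sSup
    apply image_mono
    intro f hf
    exact le_trans hf h
  have F_le : ∀ f c, e' f ≤ c → ι f ≤ F c := fun f c h => le_sSup ⟨f, h, rfl⟩
  have F_compl : ∀ a, F aᶜ = (F a)ᶜ := by
    intro a
    symm
    apply IsCompl.compl_eq
    refine ⟨?_, ?_⟩
    · rw [disjoint_iff]
      apply le_bot_iff.1
      rw [sSup_inf_eq]
      refine iSup₂_le ?_
      rintro _ ⟨f, hf, rfl⟩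
      rw [inf_sSup_eq]
      refine iSup₂_le ?_
      rintro _ ⟨g, hg, rfl⟩
      apply le_of_eq
      apply ι_disj
      intro h
      apply (he'₃ f g).1 h
      apply le_bot_iff.1
      calc e' f ⊓ e' g ≤ a ⊓ aᶜ := inf_le_inf hf hg
        _ = ⊥ := by simp
    · rw [codisjoint_iff]
      apply top_le_iff.1
      rw [← ι_dense {f | e' f ≤ a ∨ e' f ≤ aᶜ}]
      · apply sSup_le
        rintro _ ⟨f, hf | hf, rfl⟩
        · exact (F_le _ _ hf).trans le_sup_left
        · exact (F_le _ _ hf).trans le_sup_right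
      · rintro f g h (h1 | h1)
        · exact Or.inl ((he'₂ _ _ h).trans h1)
        · exact Or.inr ((he'₂ _ _ h).trans h1)
      · intro f
        by_cases h : e' f ⊓ a = ⊥
        · exact ⟨f, le_rfl, Or.inr (le_compl_iff_disjoint_right.2 (disjoint_iff.2 h))⟩
        · obtain ⟨r, h1, h2⟩ := refine_ f a h
          exact ⟨r, h1, Or.inl h2⟩
  have F_sSup : ∀ S : Set C, F (sSup S) = sSup (F '' S) := by
    intro S
    apply le_antisymm
    · apply sSup_le
      rintro _ ⟨f, hf, rfl⟩
      have hf : e' f ≤ sSup S := hf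
      have hd := ι_dense {g | (∃ s ∈ S, e' g ≤ s) ∨ ¬ ∃ r, r ≤ f ∧ r ≤ g} ?_ ?_
      · rw [← inf_top_eq (ι f), ← hd, inf_sSup_eq]
        refine iSup₂_le ?_
        rintro _ ⟨g, ⟨s, hs, h⟩ | h, rfl⟩
        · exact inf_le_right.trans ((F_le _ _ h).trans (le_sSup ⟨s, hs, rfl⟩))
        · rw [ι_disj _ _ h]; exact bot_le
      · rintro g h hgh (⟨s, hs, h1⟩ | h1)
        · exact Or.inl ⟨s, hs, (he'₂ _ _ hgh).trans h1⟩
        · right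
          rintro ⟨r, hr1, hr2⟩
          exact h1 ⟨r, hr1, hr2.trans hgh⟩
      · intro g
        by_cases h : ∃ r, r ≤ f ∧ r ≤ g
        · obtain ⟨r, hr1, hr2⟩ := h
          have : ∃ s ∈ S, e' r ⊓ s ≠ ⊥ := by
            by_contra! hcon
            apply he'₁ r
            have : e' r = e' r ⊓ sSup S := (inf_eq_left.2 ((he'₂ _ _ hr1).trans hf)).symm
            rw [this, inf_sSup_eq]
            apply le_bot_iff.1
            refine iSup₂_le ?_
            intro s hs
            exact (hcon s hs).le
          obtain ⟨s, hs, h⟩ := this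
          obtain ⟨r', h1, h2⟩ := refine_ _ _ h
          exact ⟨r', h1.trans hr2, Or.inl ⟨s, hs, h2⟩⟩
        · exact ⟨g, le_rfl, Or.inr h⟩
    · apply sSup_le
      rintro _ ⟨s, hs, rfl⟩
      exact F_mono _ _ (le_sSup hs)
  have F_bot : F ⊥ = ⊥ := by
    have := F_sSup ∅
    simpa using this
  have F_sup : ∀ a b, F (a ⊔ b) = F a ⊔ F b := by
    intro a b
    have := F_sSup {a, b}
    rw [sSup_pair, image_pair, sSup_pair] at this
    exact this
  have F_inf : ∀ a b, F (a ⊓ b) = F a ⊓ F b := by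
    intro a b
    have h : a ⊓ b = (aᶜ ⊔ bᶜ)ᶜ := by simp
    rw [h, F_compl, F_sup, F_compl, F_compl]; simp
  have F_eqbot : ∀ c, F c = ⊥ → c = ⊥ := by
    intro c h
    by_contra hc
    obtain ⟨f, hf⟩ := he'₄ c hc
    exact ι_ne f (le_bot_iff.1 (h ▸ F_le f c hf))
  have F_le' : ∀ a b, F a = F b → a ≤ b := by
    intro a b h
    have : F (a ⊓ bᶜ) = ⊥ := by rw [F_inf, F_compl, h]; simp
    have := F_eqbot _ this
    rwa [← disjoint_iff, disjoint_compl_right_iff] at this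
  refine ⟨F, fun a b h => le_antisymm (F_le' _ _ h) (F_le' _ _ h.symm), F_bot, ?_, F_inf, F_sup,
    F_compl, F_sSup, ?_⟩
  · rw [← compl_bot, F_compl, F_bot, compl_bot]
  · intro S
    have h : sInf S = (sSup (compl '' S))ᶜ := by
      rw [compl_sSup', ← image_comp]; simp
    rw [h, F_compl, F_sSup, compl_sSup', ← image_comp, ← image_comp]
    congr 1
    apply image_congr
    intro a _
    simp [F_compl]

/-- The first uncountable ordinal. -/
abbrev W1 : Ordinal.{0} := (Cardinal.aleph 1).ord

theorem W1_succ {x : Ordinal.{0}} (h : x < W1) : x + 1 < W1 := by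
  have := (Cardinal.isSuccLimit_ord (c := Cardinal.aleph 1) (Cardinal.aleph0_le_aleph 1)).succ_lt h
  simpa using this

theorem W1_pos : (0 : Ordinal.{0}) < W1 := by
  rw [Cardinal.lt_ord]; simp

theorem W1_sup {α : Type*} [Countable α] (f : α → Ordinal.{0}) (h : ∀ i, f i < W1) :
    ⨆ i, f i < W1 := by
  unfold W1
  rw [Cardinal.ord_aleph]
  apply Ordinal.iSup_lt_omega_one
  intro i
  rw [← Cardinal.ord_aleph]; exact h i

theorem W1_countable {x : Ordinal.{0}} (h : x < W1) : (Iio x).Countable := by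
  rw [← Cardinal.le_aleph0_iff_set_countable, Cardinal.mk_Iio_ordinal]
  rw [Cardinal.lt_ord, ← Cardinal.succ_aleph0, Order.lt_succ_iff] at h
  exact Cardinal.lift_le_aleph0.2 h

theorem W1_card : #(Iio W1) = Cardinal.aleph 1 := by
  rw [Cardinal.mk_Iio_ordinal]; simp

theorem card_biUnion_le {α ι : Type 1} {M : Cardinal.{1}} (hM : ℵ₀ ≤ M) (s : Set ι)
    (A : ι → Set α) (hs : #s ≤ M) (hA : ∀ x ∈ s, #(A x) ≤ M) : #(⋃ x ∈ s, A x : Set α) ≤ M := by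
  refine (Cardinal.mk_biUnion_le A s).trans ?_
  calc #s * ⨆ x : s, #(A x) ≤ M * M := by
        refine mul_le_mul' hs (ciSup_le' fun x => hA x x.2)
    _ = M := Cardinal.mul_eq_self hM

section poset

variable {K : Type 1} [Preorder K]

/-- Compatibility of two conditions. -/
def Cmp (a b : K) : Prop := ∃ r, r ≤ a ∧ r ≤ b

theorem Cmp.refl (a : K) : Cmp a a := ⟨a, le_rfl, le_rfl⟩

theorem Cmp.symm {a b : K} (h : Cmp a b) : Cmp b a := by
  obtain ⟨r, h1, h2⟩ := h
  exact ⟨r, h2, h1⟩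

theorem Cmp.mono {a b a' b' : K} (h : Cmp a b) (ha : a ≤ a') (hb : b ≤ b') : Cmp a' b' := by
  obtain ⟨r, h1, h2⟩ := h
  exact ⟨r, h1.trans ha, h2.trans hb⟩

/-- Countable closure. -/
def SigmaClosed (K : Type 1) [Preorder K] : Prop :=
  ∀ c : ℕ → K, (∀ n, c (n + 1) ≤ c n) → ∃ d, ∀ n, d ≤ c n

/-- Open (downward closed) sets. -/
def Opn (O : Set K) : Prop := ∀ a b, a ≤ b → b ∈ O → a ∈ O

theorem chain_lb (hσ : SigmaClosed K) {J : Type*} [LinearOrder J] [Countable J] [Nonempty J]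
    (f : J → K) (hf : ∀ i j, i ≤ j → f j ≤ f i) : ∃ d, ∀ j, d ≤ f j := by
  obtain ⟨e, he⟩ := exists_surjective_nat J
  let m : ℕ → J := fun n => Nat.rec (e 0) (fun n r => max r (e (n + 1))) n
  have hm : ∀ n, e n ≤ m n := by
    intro n
    cases n with
    | zero => exact le_rfl
    | succ n => exact le_max_right _ _
  obtain ⟨d, hd⟩ := hσ (fun n => f (m n)) (fun n => hf _ _ (le_max_left _ _))
  refine ⟨d, fun j => ?_⟩
  obtain ⟨n, rfl⟩ := he j
  exact (hd n).trans (hf _ _ (hm n))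

theorem dense_inter_nat (hσ : SigmaClosed K) (O : ℕ → Set K) (hO : ∀ n, Opn (O n))
    (hd : ∀ n q, ∃ r, r ≤ q ∧ r ∈ O n) (q : K) : ∃ r, r ≤ q ∧ ∀ n, r ∈ O n := by
  choose s hs1 hs2 using hd
  let c : ℕ → K := fun n => Nat.rec q (fun n r => s n r) n
  obtain ⟨d, hd⟩ := hσ c (fun n => hs1 n (c n))
  exact ⟨d, hd 0, fun n => hO n _ _ (hd (n + 1)) (hs2 n (c n))⟩

theorem dense_inter (hσ : SigmaClosed K) {ι : Type*} (s : Set ι) (hs : s.Countable)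
    (O : ι → Set K) (hO : ∀ i ∈ s, Opn (O i))
    (hd : ∀ i ∈ s, ∀ q, ∃ r, r ≤ q ∧ r ∈ O i) (q : K) : ∃ r, r ≤ q ∧ ∀ i ∈ s, r ∈ O i := by
  rcases s.eq_empty_or_nonempty with rfl | hne
  · exact ⟨q, le_rfl, by simp⟩
  obtain ⟨f, rfl⟩ := hs.exists_eq_range hne
  obtain ⟨r, h1, h2⟩ := dense_inter_nat hσ (fun n => O (f n)) (fun n => hO _ ⟨n, rfl⟩)
    (fun n => hd _ ⟨n, rfl⟩) q
  exact ⟨r, h1, by rintro _ ⟨n, rfl⟩; exact h2 n⟩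

/-- Antichains. -/
def Anti (A : Set K) : Prop := ∀ a ∈ A, ∀ b ∈ A, Cmp a b → a = b

theorem max_antichain (O A0 : Set K) (h0 : A0 ⊆ O) (hA0 : Anti A0) :
    ∃ A, A0 ⊆ A ∧ A ⊆ O ∧ Anti A ∧ ∀ d ∈ O, ∃ a ∈ A, Cmp d a := by
  obtain ⟨A, hA, hmax⟩ := zorn_subset_nonempty {A : Set K | A ⊆ O ∧ Anti A} (by
    intro c hc hch hne
    refine ⟨⋃₀ c, ⟨sUnion_subset fun s hs => (hc hs).1, ?_⟩, fun s hs => subset_sUnion_of_mem hs⟩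
    rintro a ⟨s, hs, ha⟩ b ⟨t, ht, hb⟩ hab
    rcases hch.total hs ht with h | h
    · exact (hc ht).2 a (h ha) b hb hab
    · exact (hc hs).2 a ha b (h hb) hab) A0 ⟨h0, hA0⟩
  refine ⟨A, hA, hmax.prop.1, hmax.prop.2, ?_⟩
  intro d hd
  by_contra! hcon
  have : insert d A ⊆ A := hmax.le_of_ge (y := insert d A) ⟨insert_subset hd hmax.prop.1, by
    rintro a (rfl | ha) b (rfl | hb) hab
    · rfl
    · exact absurd hab (hcon b hb)
    · exact absurd hab.symm (hcon a ha)
    · exact hmax.prop.2 a ha b hb hab⟩ (subset_insert _ _)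
  exact hcon d (this (mem_insert _ _)) (Cmp.refl d)

end poset

section rank

variable {K : Type 1} (M : Cardinal.{1}) (i : K → Ordinal.{0}) (Ch : K → Set K)
  (child : K → K → K)

/-- Rank predicate: `r` leaves the `δ`-good part with rank at most `α`. -/
inductive OutR (δ : Ordinal.{0}) : Ordinal.{1} → K → Prop
  | base (α : Ordinal.{1}) (r : K) (h : δ ≤ i r) : OutR δ α r
  | step (α : Ordinal.{1}) (r : K) (S : Set K) (hS : #S ≤ M) (β : K → Ordinal.{1})
      (hβ : ∀ t ∈ Ch r, t ∉ S → β t < α)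
      (h : ∀ t ∈ Ch r, t ∉ S → OutR δ (β t) (child r t)) : OutR δ α r

theorem rank_lemma (hM : Cardinal.aleph 1 ≤ M) (hi : ∀ r, i r < W1) (hCh : ∀ r, M < #(Ch r))
    (q : K) :
    ∃ δ < W1, ∃ W : Set K, q ∈ W ∧ ∀ r ∈ W, i r < δ ∧ M < #{t | t ∈ Ch r ∧ child r t ∈ W} := by
  by_cases hgood : ∃ δ < W1, ∀ α, ¬ OutR M i Ch child δ α q
  · obtain ⟨δ, hδ, hq⟩ := hgood
    refine ⟨δ, hδ, {r | ∀ α, ¬ OutR M i Ch child δ α r}, hq, ?_⟩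
    intro r hr
    constructor
    · by_contra! h
      exact hr 0 (OutR.base 0 r h)
    · by_contra! h
      classical
      let β : K → Ordinal.{1} := fun t =>
        if h : ∃ α, OutR M i Ch child δ α (child r t) then h.choose else 0
      refine hr ((⨆ t, β t) + 1) (OutR.step _ r _ h β ?_ ?_)
      · intro t _ _
        exact Order.lt_add_one_iff.2 (Ordinal.le_iSup β t)
      · intro t ht hS
        have h : ∃ α, OutR M i Ch child δ α (child r t) := by
          by_contra! h
          exact hS ⟨ht, h⟩
        simp only [β, dif_pos h]
        exact h.choose_spec
  · exfalso
    push Not at hgood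
    choose! ρ0 hρ0 using hgood
    have hM0 : ℵ₀ ≤ M := (Cardinal.aleph0_le_aleph 1).trans hM
    let St := {x : K × Ordinal.{0} × (Ordinal.{0} → Ordinal.{1}) //
      x.2.1 < W1 ∧ ∀ δ, x.2.1 ≤ δ → δ < W1 → OutR M i Ch child δ (x.2.2 δ) x.1}
    have hstep : ∀ x : St, ∃ y : St, x.1.2.1 ≤ y.1.2.1 ∧
        ∀ δ, y.1.2.1 ≤ δ → δ < W1 → y.1.2.2 δ < x.1.2.2 δ := by
      rintro ⟨⟨r, ε, ρ⟩, hε, hρ⟩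
      simp only at hε hρ
      set ε' := max ε (i r + 1) with hε'
      have h1 : ∀ δ, ε' ≤ δ → δ < W1 → ∃ S : Set K, #S ≤ M ∧ ∃ β : K → Ordinal.{1},
          ∀ t ∈ Ch r, t ∉ S → β t < ρ δ ∧ OutR M i Ch child δ (β t) (child r t) := by
        intro δ h1 h2
        have := hρ δ ((le_max_left _ _).trans h1) h2
        cases this with
        | base _ _ h =>
          exfalso
          have h3 : i r + 1 ≤ δ := (le_max_right _ _).trans h1
          exact absurd (Order.add_one_le_iff.1 h3) (not_lt.2 h)
        | step _ _ S hS β hβ h => exact ⟨S, hS, β, fun t ht hS => ⟨hβ t ht hS, h t ht hS⟩⟩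
      choose! S hS β hβ using h1
      have hU : #(⋃ δ ∈ {δ | ε' ≤ δ ∧ δ < W1}, S δ : Set K) ≤ M := by
        apply card_biUnion_le hM0
        · refine le_trans ?_ hM
          rw [← W1_card]
          exact Cardinal.mk_le_mk_of_subset fun x hx => hx.2
        · intro x hx
          exact hS x hx.1 hx.2
      have : ∃ t ∈ Ch r, t ∉ (⋃ δ ∈ {δ | ε' ≤ δ ∧ δ < W1}, S δ : Set K) := by
        by_contra! hcon
        exact absurd ((Cardinal.mk_le_mk_of_subset hcon).trans hU) (not_le.2 (hCh r))
      obtain ⟨t, ht, htS⟩ := this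
      have hnot : ∀ δ, ε' ≤ δ → δ < W1 → t ∉ S δ := by
        intro δ h1 h2 h3
        exact htS (mem_biUnion (show δ ∈ {δ | ε' ≤ δ ∧ δ < W1} from ⟨h1, h2⟩) h3)
      refine ⟨⟨⟨child r t, ε', fun δ => β δ t⟩, max_lt hε (W1_succ (hi r)), ?_⟩,
        le_max_left _ _, ?_⟩
      · intro δ h1 h2
        exact (hβ δ h1 h2 t ht (hnot δ h1 h2)).2
      · intro δ h1 h2
        exact (hβ δ h1 h2 t ht (hnot δ h1 h2)).1
    choose nx hnx1 hnx2 using hstep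
    let x0 : St := ⟨⟨q, 0, ρ0⟩, W1_pos, fun δ _ h => hρ0 δ h⟩
    let c : ℕ → St := fun n => Nat.rec x0 (fun _ x => nx x) n
    let δ := ⨆ n, (c n).1.2.1
    have hδ : δ < W1 := W1_sup _ fun n => (c n).2.1
    have hle : ∀ n, (c n).1.2.1 ≤ δ := fun n => Ordinal.le_iSup (fun n => (c n).1.2.1) n
    have hdec : ∀ n, (c (n + 1)).1.2.2 δ < (c n).1.2.2 δ :=
      fun n => hnx2 (c n) δ (hle (n + 1)) hδ
    exact (RelEmbedding.natGT (r := (· < ·)) (fun n => (c n).1.2.2 δ) hdec).not_wellFounded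
      (wellFounded_lt)

end rank

theorem transversal {K : Type 1} {Λ : Cardinal.{1}} (hK : #K ≤ Λ) (G : Set K) (A : K → Set K)
    (hA : ∀ k ∈ G, Λ ≤ #(A k)) :
    ∃ m : K → K, (∀ k ∈ G, m k ∈ A k) ∧ ∀ k ∈ G, ∀ k' ∈ G, m k = m k' → k = k' := by
  classical
  obtain ⟨r, wo, hr⟩ := Cardinal.ord_eq K
  have wf : WellFounded r := wo.wf
  have hex : ∀ (k : K) (f : ∀ j, r j k → K), k ∈ G → ∃ x ∈ A k, ∀ j h, f j h ≠ x := by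
    intro k f hk
    by_contra! hcon
    have h1 : A k ⊆ range (fun j : {j // r j k} => f j.1 j.2) := by
      intro x hx
      obtain ⟨j, h, e⟩ := hcon x hx
      exact ⟨⟨j, h⟩, e⟩
    have h2 := (Cardinal.mk_le_mk_of_subset h1).trans Cardinal.mk_range_le
    have h3 := Cardinal.card_typein_lt k hr
    rw [Ordinal.card_typein] at h3
    exact absurd ((hA k hk).trans h2) (not_le.2 (h3.trans_le hK))
  let F : ∀ k, (∀ j, r j k → K) → K := fun k f =>
    if h : k ∈ G then (hex k f h).choose else k
  let m : K → K := wf.fix F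
  have hm : ∀ k, m k = F k (fun j _ => m j) := fun k => wf.fix_eq F k
  have hspec : ∀ k ∈ G, m k ∈ A k ∧ ∀ j, r j k → m j ≠ m k := by
    intro k hk
    have h := (hex k (fun j _ => m j) hk).choose_spec
    have e : m k = (hex k (fun j _ => m j) hk).choose := by
      rw [hm k]; simp only [F, dif_pos hk]
    rw [← e] at h
    exact ⟨h.1, h.2⟩
  refine ⟨m, fun k hk => (hspec k hk).1, fun k hk k' hk' h => ?_⟩
  rcases trichotomous_of r k k' with h1 | h1 | h1
  · exact absurd h ((hspec k' hk').2 k h1)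
  · exact h1
  · exact absurd h.symm ((hspec k hk).2 k' h1)

/-- A base matrix of antichains of height `ω₁`. -/
structure BaseMatrix (K : Type 1) [Preorder K] (M : Cardinal.{1}) (T : Ordinal.{0} → Set K) :
    Prop where
  anti : ∀ i < W1, Anti (T i)
  max : ∀ i < W1, ∀ q, ∃ t ∈ T i, Cmp q t
  ref : ∀ i < W1, ∀ j < i, ∀ t ∈ T i, ∃ t' ∈ T j, t ≤ t'
  big : ∀ q, ∃ i < W1, M < #{t | t ∈ T i ∧ Cmp q t}

theorem big_level {K : Type 1} [Preorder K] {M : Cardinal.{1}} {T : Ordinal.{0} → Set K}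
    (hσ : SigmaClosed K) (hM : Cardinal.aleph 1 ≤ M) (hT : BaseMatrix K M T) (q : K) :
    ∃ δ < W1, M ^ ℵ₀ ≤ #{t | t ∈ T δ ∧ Cmp q t} := by
  classical
  choose i hi hbig using hT.big
  let Ch : K → Set K := fun r => {t | t ∈ T (i r) ∧ Cmp r t}
  let child : K → K → K := fun r t => if h : Cmp r t then h.choose else r
  have hch : ∀ r t, t ∈ Ch r → child r t ≤ r ∧ child r t ≤ t := by
    intro r t ht
    simp only [child, dif_pos ht.2]
    exact ht.2.choose_spec
  obtain ⟨δ, hδ, W, hqW, hW⟩ := rank_lemma M i Ch child hM hi hbig q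
  refine ⟨δ, hδ, ?_⟩
  have hφ : ∀ r ∈ W, ∃ φ : M.out → K, Function.Injective φ ∧
      ∀ y, φ y ∈ Ch r ∧ child r (φ y) ∈ W := by
    intro r hr
    have h1 : #M.out ≤ #{t | t ∈ Ch r ∧ child r t ∈ W} := by
      rw [Cardinal.mk_out]; exact (hW r hr).2.le
    obtain ⟨f⟩ := h1
    exact ⟨fun y => (f y).1, fun a b h => f.injective (Subtype.ext h), fun y => (f y).2⟩
  choose! φ hφi hφ using hφ
  let R : (ℕ → M.out) → ℕ → K := fun y n => Nat.rec q (fun n r => child r (φ r (y n))) n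
  have hRs : ∀ y n, R y (n + 1) = child (R y n) (φ (R y n) (y n)) := fun y n => rfl
  have hRW : ∀ y n, R y n ∈ W := by
    intro y n
    induction n with
    | zero => exact hqW
    | succ n ih => rw [hRs]; exact (hφ _ ih _).2
  have hRd : ∀ y n, R y (n + 1) ≤ R y n ∧ R y (n + 1) ≤ φ (R y n) (y n) := by
    intro y n
    rw [hRs]
    exact hch _ _ (hφ _ (hRW y n) _).1
  have hlb : ∀ y, ∃ t ∈ T δ, ∃ d, d ≤ t ∧ ∀ n, d ≤ R y n := by
    intro y
    obtain ⟨d, hd⟩ := hσ (R y) (fun n => (hRd y n).1)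
    obtain ⟨t, ht, r, hr1, hr2⟩ := hT.max δ hδ d
    exact ⟨t, ht, r, hr2, fun n => hr1.trans (hd n)⟩
  choose t ht d hd1 hd2 using hlb
  have hinj : Function.Injective t := by
    intro y y' h
    by_contra hne
    have hex : ∃ n, y n ≠ y' n := by
      by_contra! hcon; exact hne (funext hcon)
    let n := Nat.find hex
    have hn : y n ≠ y' n := Nat.find_spec hex
    have hlt : ∀ m < n, y m = y' m := fun m hm => not_not.1 (Nat.find_min hex hm)
    have hR : ∀ m ≤ n, R y m = R y' m := by
      intro m
      induction m with
      | zero => intro _; rfl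
      | succ m ih =>
        intro hm
        rw [hRs, hRs, ih (by omega), hlt m (by omega)]
    have hr := hRW y n
    apply hn
    apply hφi _ hr
    obtain ⟨t'', ht'', hle⟩ := hT.ref δ hδ _ (hW _ hr).1 (t y) (ht y)
    have hI := hT.anti _ (hi (R y n))
    have e1 : t'' = φ (R y n) (y n) := by
      apply hI _ ht'' _ (hφ _ hr _).1.1
      exact ⟨d y, (hd1 y).trans hle, (hd2 y (n + 1)).trans (hRd y n).2⟩
    have e2 : t'' = φ (R y n) (y' n) := by
      apply hI _ ht'' _ (hφ _ hr _).1.1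
      refine ⟨d y', (hd1 y').trans (h ▸ hle), ?_⟩
      rw [hR n le_rfl]
      exact (hd2 y' (n + 1)).trans (hRd y' n).2
    rw [← e1, ← e2]
  have hcard : M ^ ℵ₀ = #(ℕ → M.out) := by
    simp
  rw [hcard]
  refine ⟨⟨fun y => ⟨t y, ht y, d y, hd2 y 0, hd1 y⟩, ?_⟩⟩
  intro y y' h
  exact hinj (congrArg Subtype.val h)

theorem pick_exists {K : Type 1} [Preorder K] {M : Cardinal.{1}} {T : Ordinal.{0} → Set K}
    (hσ : SigmaClosed K) (hM : Cardinal.aleph 1 ≤ M) (hT : BaseMatrix K M T)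
    (lam : Cardinal.{0}) (hlam : Cardinal.lift.{1} lam = M ^ ℵ₀) (hK : #K ≤ M ^ ℵ₀)
    (m : Ordinal.{0} → K → K)
    (hm : ∀ i, ∀ k, M ^ ℵ₀ ≤ #{t | t ∈ T i ∧ Cmp k t} → m i k ∈ T i ∧ Cmp k (m i k))
    (hmi : ∀ i, ∀ k k', M ^ ℵ₀ ≤ #{t | t ∈ T i ∧ Cmp k t} →
      M ^ ℵ₀ ≤ #{t | t ∈ T i ∧ Cmp k' t} → m i k = m i k' → k = k')
    (i : Ordinal.{0}) (hi : i < W1) (N : Set K) (hN : Opn N) (hne : N.Nonempty) :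
    ∃ P : Ordinal.{0} → K,
      (∀ ξ < lam.ord, P ξ ∈ N) ∧
      (∀ ξ < lam.ord, ∃ t ∈ T i, P ξ ≤ t) ∧
      (∀ ξ < lam.ord, ∀ ξ' < lam.ord, Cmp (P ξ) (P ξ') → ξ = ξ') ∧
      (∀ d ∈ N, ∃ ξ < lam.ord, Cmp d (P ξ)) ∧
      (∀ ξ < lam.ord, ∀ k, M ^ ℵ₀ ≤ #{t | t ∈ T i ∧ Cmp k t} → P ξ ≤ m i k →
        P ξ ≤ k ∨ ¬ Cmp (P ξ) k) := by
  classical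
  let O : Set K := {d | d ∈ N ∧ (∃ t ∈ T i, d ≤ t) ∧
    ∀ k, M ^ ℵ₀ ≤ #{t | t ∈ T i ∧ Cmp k t} → d ≤ m i k → d ≤ k ∨ ¬ Cmp d k}
  have hdense : ∀ d ∈ N, ∃ d' ≤ d, d' ∈ O := by
    intro d hd
    obtain ⟨t, ht, d1, h1, h2⟩ := hT.max i hi d
    have hd1 : d1 ∈ N := hN _ _ h1 hd
    have huniq : ∀ k, M ^ ℵ₀ ≤ #{t | t ∈ T i ∧ Cmp k t} → ∀ d' ≤ d1, d' ≤ m i k → m i k = t := by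
      intro k hk d' hd' hle
      exact hT.anti i hi _ (hm i k hk).1 _ ht ⟨d', hle, hd'.trans h2⟩
    by_cases hk : ∃ k, M ^ ℵ₀ ≤ #{t | t ∈ T i ∧ Cmp k t} ∧ m i k = t
    · obtain ⟨k, hk1, hk2⟩ := hk
      by_cases hc : Cmp d1 k
      · obtain ⟨r, hr1, hr2⟩ := hc
        refine ⟨r, hr1.trans h1, hN _ _ hr1 hd1, ⟨t, ht, hr1.trans h2⟩, ?_⟩
        intro k' hk' hle
        have e := huniq k' hk' r hr1 hle
        have : k' = k := hmi i _ _ hk' hk1 (e.trans hk2.symm)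
        exact Or.inl (this ▸ hr2)
      · refine ⟨d1, h1, hd1, ⟨t, ht, h2⟩, ?_⟩
        intro k' hk' hle
        have e := huniq k' hk' d1 le_rfl hle
        have : k' = k := hmi i _ _ hk' hk1 (e.trans hk2.symm)
        exact Or.inr (this ▸ hc)
    · refine ⟨d1, h1, hd1, ⟨t, ht, h2⟩, ?_⟩
      intro k' hk' hle
      exact absurd ⟨k', hk', huniq k' hk' d1 le_rfl hle⟩ hk
  obtain ⟨n, hn⟩ := hne
  obtain ⟨δ, hδ, hbig⟩ := big_level hσ hM hT n
  have hsel : ∀ t ∈ {t | t ∈ T δ ∧ Cmp n t}, ∃ d, d ≤ t ∧ d ∈ O := by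
    rintro t ⟨ht, r, hr1, hr2⟩
    obtain ⟨d', h1, h2⟩ := hdense r (hN _ _ hr1 hn)
    exact ⟨d', h1.trans hr2, h2⟩
  choose! s hs1 hs2 using hsel
  have hsc : ∀ t ∈ {t | t ∈ T δ ∧ Cmp n t}, ∀ t' ∈ {t | t ∈ T δ ∧ Cmp n t},
      Cmp (s t) (s t') → t = t' := by
    intro t ht t' ht' h
    exact hT.anti δ hδ _ ht.1 _ ht'.1 (h.mono (hs1 t ht) (hs1 t' ht'))
  obtain ⟨A, hA0, hAO, hAanti, hAmax⟩ := max_antichain O (s '' {t | t ∈ T δ ∧ Cmp n t}) (by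
    rintro _ ⟨t, ht, rfl⟩
    exact hs2 t ht) (by
    rintro _ ⟨t, ht, rfl⟩ _ ⟨t', ht', rfl⟩ h
    rw [hsc t ht t' ht' h])
  have hAcard : #A = M ^ ℵ₀ := by
    apply le_antisymm ((Cardinal.mk_set_le A).trans hK)
    refine hbig.trans ?_
    refine le_trans ?_ (Cardinal.mk_le_mk_of_subset hA0)
    rw [Cardinal.mk_image_eq_of_injOn]
    intro t ht t' ht' h
    exact hsc t ht t' ht' (by rw [h]; exact Cmp.refl _)
  have : #(Iio lam.ord) = #A := by
    rw [hAcard, Cardinal.mk_Iio_ordinal, Cardinal.card_ord, ← hlam]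
  obtain ⟨E⟩ := Cardinal.eq.1 this
  have hP : ∀ ξ (h : ξ < lam.ord),
      (if h : ξ < lam.ord then (E ⟨ξ, h⟩).1 else n) = (E ⟨ξ, h⟩).1 := fun ξ h => dif_pos h
  refine ⟨fun ξ => if h : ξ < lam.ord then (E ⟨ξ, h⟩).1 else n, ?_, ?_, ?_, ?_, ?_⟩
  · intro ξ h
    simp only [hP ξ h]
    exact (hAO (E ⟨ξ, h⟩).2).1
  · intro ξ h
    simp only [hP ξ h]
    exact (hAO (E ⟨ξ, h⟩).2).2.1
  · intro ξ h ξ' h' hc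
    simp only [hP ξ h, hP ξ' h'] at hc
    have := hAanti _ (E ⟨ξ, h⟩).2 _ (E ⟨ξ', h'⟩).2 hc
    have := E.injective (Subtype.ext this)
    exact congrArg Subtype.val this
  · intro d hd
    obtain ⟨d', h1, h2⟩ := hdense d hd
    obtain ⟨a, ha, hc⟩ := hAmax d' h2
    obtain ⟨⟨ξ, h⟩, hξ⟩ := E.surjective ⟨a, ha⟩
    refine ⟨ξ, h, ?_⟩
    have e : (if h : ξ < lam.ord then (E ⟨ξ, h⟩).1 else n) = a :=
      (hP ξ h).trans (congrArg Subtype.val hξ)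
    show Cmp d (if h : ξ < lam.ord then (E ⟨ξ, h⟩).1 else n)
    rw [e]
    exact hc.mono h1 le_rfl
  · intro ξ h
    simp only [hP ξ h]
    exact (hAO (E ⟨ξ, h⟩).2).2.2

/-- The tree of conditions obtained from a picking function. -/
def treeD {K : Type 1} [Preorder K] (pick : Ordinal.{0} → Set K → Ordinal.{0} → K)
    (g : Ordinal.{0} → Ordinal.{0}) (i : Ordinal.{0}) : K :=
  pick i {d | ∀ j, (_ : j < i) → d ≤ treeD pick g j} (g i)
termination_by i

/-- Conditions lying below the branch of `g` of length `i`. -/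
def treeN {K : Type 1} [Preorder K] (pick : Ordinal.{0} → Set K → Ordinal.{0} → K)
    (g : Ordinal.{0} → Ordinal.{0}) (i : Ordinal.{0}) : Set K :=
  {d | ∀ j, j < i → d ≤ treeD pick g j}

theorem treeD_eq {K : Type 1} [Preorder K] (pick : Ordinal.{0} → Set K → Ordinal.{0} → K)
    (g : Ordinal.{0} → Ordinal.{0}) (i : Ordinal.{0}) :
    treeD pick g i = pick i (treeN pick g i) (g i) := by
  rw [treeD]; rfl

theorem treeD_congr {K : Type 1} [Preorder K] (pick : Ordinal.{0} → Set K → Ordinal.{0} → K)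
    (g g' : Ordinal.{0} → Ordinal.{0}) (i : Ordinal.{0}) (h : ∀ j ≤ i, g j = g' j) :
    treeD pick g i = treeD pick g' i := by
  induction i using WellFoundedLT.induction with
  | ind i ih =>
    rw [treeD_eq, treeD_eq, h i le_rfl]
    congr 1
    ext d
    constructor
    · intro hd j hj
      rw [← ih j hj fun j' hj' => h j' (hj'.trans hj.le)]
      exact hd j hj
    · intro hd j hj
      rw [ih j hj fun j' hj' => h j' (hj'.trans hj.le)]
      exact hd j hj

theorem treeN_congr {K : Type 1} [Preorder K] (pick : Ordinal.{0} → Set K → Ordinal.{0} → K)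
    (g g' : Ordinal.{0} → Ordinal.{0}) (i : Ordinal.{0}) (h : ∀ j < i, g j = g' j) :
    treeN pick g i = treeN pick g' i := by
  ext d
  constructor
  · intro hd j hj
    rw [← treeD_congr pick g g' j fun j' hj' => h j' (hj'.trans_lt hj)]
    exact hd j hj
  · intro hd j hj
    rw [treeD_congr pick g g' j fun j' hj' => h j' (hj'.trans_lt hj)]
    exact hd j hj

theorem treeN_opn {K : Type 1} [Preorder K] (pick : Ordinal.{0} → Set K → Ordinal.{0} → K)
    (g : Ordinal.{0} → Ordinal.{0}) (i : Ordinal.{0}) : Opn (treeN pick g i) :=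
  fun _ _ h hb j hj => h.trans (hb j hj)

section tree

variable {K : Type 1} [Preorder K]

theorem treeN_nonempty (hσ : SigmaClosed K) [Nonempty K] (L : Ordinal.{0})
    (pick : Ordinal.{0} → Set K → Ordinal.{0} → K)
    (hmem : ∀ i < W1, ∀ N : Set K, Opn N → N.Nonempty → ∀ ξ < L, pick i N ξ ∈ N)
    (g : Ordinal.{0} → Ordinal.{0}) (hg : ∀ j, g j < L) (i : Ordinal.{0})
    (hi : i < W1) : (treeN pick g i).Nonempty ∧ treeD pick g i ∈ treeN pick g i := by
  induction i using WellFoundedLT.induction with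
  | ind i ih =>
    have h1 : (treeN pick g i).Nonempty := by
      rcases eq_or_ne i 0 with rfl | h0
      · exact ⟨Classical.arbitrary K, fun j hj => absurd hj (by simp)⟩
      · have : Nonempty (Iio i) := ⟨⟨0, pos_iff_ne_zero.2 h0⟩⟩
        have : Countable (Iio i) := (W1_countable hi).to_subtype
        obtain ⟨d, hd⟩ := chain_lb hσ (fun j : Iio i => treeD pick g j) (by
          rintro ⟨j, hj⟩ ⟨j', hj'⟩ h
          rcases eq_or_lt_of_le h with h | h
          · rw [h]
          · exact (ih j' hj' (lt_trans hj' hi)).2 j h)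
        exact ⟨d, fun j hj => hd ⟨j, hj⟩⟩
    refine ⟨h1, ?_⟩
    rw [treeD_eq]
    exact hmem i hi _ (treeN_opn pick g i) h1 _ (hg i)

theorem tree_unique (hσ : SigmaClosed K) [Nonempty K] (L : Ordinal.{0})
    (pick : Ordinal.{0} → Set K → Ordinal.{0} → K)
    (hmem : ∀ i < W1, ∀ N : Set K, Opn N → N.Nonempty → ∀ ξ < L, pick i N ξ ∈ N)
    (hinj : ∀ i < W1, ∀ N : Set K, Opn N → N.Nonempty → ∀ ξ < L, ∀ ξ' < L,
      Cmp (pick i N ξ) (pick i N ξ') → ξ = ξ')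
    (g g' : Ordinal.{0} → Ordinal.{0}) (hg : ∀ j, g j < L) (hg' : ∀ j, g' j < L)
    (i : Ordinal.{0}) (hi : i ≤ W1) (d : K) (hd : d ∈ treeN pick g i) (hd' : d ∈ treeN pick g' i) :
    ∀ j < i, g j = g' j := by
  intro j
  induction j using WellFoundedLT.induction with
  | ind j ih =>
    intro hj
    have hjW := hj.trans_le hi
    have e := treeN_congr pick g g' j fun j' hj' => ih j' hj' (hj'.trans hj)
    have h1 := hd j hj
    have h2 := hd' j hj
    rw [treeD_eq] at h1 h2
    rw [← e] at h2
    exact hinj j hjW _ (treeN_opn pick g j)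
      (treeN_nonempty hσ L pick hmem g hg j hjW).1 _ (hg j) _ (hg' j) ⟨d, h1, h2⟩

theorem tree_dense (hσ : SigmaClosed K) [Nonempty K] (L : Ordinal.{0})
    (pick : Ordinal.{0} → Set K → Ordinal.{0} → K)
    (hmem : ∀ i < W1, ∀ N : Set K, Opn N → N.Nonempty → ∀ ξ < L, pick i N ξ ∈ N)
    (hinj : ∀ i < W1, ∀ N : Set K, Opn N → N.Nonempty → ∀ ξ < L, ∀ ξ' < L,
      Cmp (pick i N ξ) (pick i N ξ') → ξ = ξ')
    (hpre : ∀ i < W1, ∀ N : Set K, Opn N → N.Nonempty → ∀ d ∈ N, ∃ ξ < L, Cmp d (pick i N ξ))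
    (hL : 0 < L) (i : Ordinal.{0}) (hi : i < W1) (d : K) :
    ∃ g : Ordinal.{0} → Ordinal.{0}, (∀ j, g j < L) ∧ ∃ d' ≤ d, d' ∈ treeN pick g i := by
  classical
  induction i using WellFoundedLT.induction generalizing d with
  | ind i ih =>
    let O : Ordinal.{0} → Set K := fun j =>
      {d | ∃ g : Ordinal.{0} → Ordinal.{0}, (∀ j, g j < L) ∧ d ∈ treeN pick g (j + 1)}
    have hO : ∀ j ∈ Iio i, Opn (O j) := by
      rintro j _ a b hab ⟨g, hg, hb⟩
      exact ⟨g, hg, treeN_opn pick g _ a b hab hb⟩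
    have hOd : ∀ j ∈ Iio i, ∀ q, ∃ r, r ≤ q ∧ r ∈ O j := by
      intro j hj q
      have hjW := lt_trans hj hi
      obtain ⟨g, hg, d', hd', hN⟩ := ih j hj hjW q
      obtain ⟨ξ, hξ, r, hr1, hr2⟩ := hpre j hjW _ (treeN_opn pick g j) ⟨d', hN⟩ d' hN
      refine ⟨r, hr1.trans hd', Function.update g j ξ, ?_, ?_⟩
      · intro j'
        by_cases h : j' = j
        · subst h; simpa using hξ
        · simpa [Function.update_of_ne h] using hg j'
      · intro j' hj'
        have hcong : ∀ k < j, g k = Function.update g j ξ k := fun k hk => by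
          rw [Function.update_of_ne hk.ne]
        rcases eq_or_lt_of_le (Order.lt_add_one_iff.1 hj') with h | h
        · subst h
          rw [treeD_eq, ← treeN_congr pick g _ j' hcong, Function.update_self]
          exact hr2
        · rw [← treeD_congr pick g _ j' fun k hk => hcong k (hk.trans_lt h)]
          exact hr1.trans (hN j' h)
    obtain ⟨r, hr, hrO⟩ := dense_inter hσ (Iio i) (W1_countable hi) O hO hOd d
    choose! G hG hGN using hrO
    refine ⟨fun j => if j < i then G j j else 0, ?_, r, hr, ?_⟩
    · intro j
      by_cases h : j < i
      · simpa [h] using hG j h j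
      · simpa [h] using hL
    · intro j hj
      rw [treeD_congr pick _ (G j) j]
      · exact hGN j hj j (by simp)
      · intro j' hj'
        have hj'i := hj'.trans_lt hj
        simp only [hj'i, if_true]
        refine tree_unique hσ L pick hmem hinj (G j') (G j) (hG j' hj'i) (hG j hj) (j' + 1)
          (W1_succ (hj'i.trans hi)).le r (hGN j' hj'i) ?_ j' (by simp)
        intro k hk
        exact hGN j hj k (hk.trans_le (by gcongr))

end tree

/-- The total function coded by a collapse condition. -/
def colG {lam : Cardinal.{0}} (f : Col lam) : Ordinal.{0} → Ordinal.{0} := fun j => (f.1 j).getD 0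

theorem colG_lt {lam : Cardinal.{0}} (h0 : 0 < lam.ord) (f : Col lam) (j : Ordinal.{0}) :
    colG f j < lam.ord := by
  obtain ⟨f, i, hi, h1, h2⟩ := f
  unfold colG
  cases h : f j with
  | none => simpa [h] using h0
  | some y => simpa [h] using h2 j y h

theorem colG_eq {lam : Cardinal.{0}} (f : Col lam) (j y : Ordinal.{0}) (h : f.1 j = some y) :
    colG f j = y := by
  simp [colG, h]

theorem col_compat {lam : Cardinal.{0}} (f g : Col lam) (i i' : Ordinal.{0})
    (h1 : ∀ j, (f.1 j).isSome ↔ j < i) (h1' : ∀ j, (g.1 j).isSome ↔ j < i')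
    (h : ∀ j < min i i', colG f j = colG g j) : ∃ r, r ≤ f ∧ r ≤ g := by
  have key : ∀ (f g : Col lam) (i i' : Ordinal.{0}) (_ : ∀ j, (f.1 j).isSome ↔ j < i)
      (_ : ∀ j, (g.1 j).isSome ↔ j < i') (_ : ∀ j < min i i', colG f j = colG g j) (_ : i ≤ i'),
      g ≤ f := by
    intro f g i i' h1 h1' h hle j y hy
    have hj : j < i := (h1 j).1 (by simp [hy])
    have hj' : j < i' := hj.trans_le hle
    obtain ⟨z, hz⟩ := Option.isSome_iff_exists.1 ((h1' j).2 hj')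
    have e := h j (lt_min hj hj')
    rw [colG_eq f j y hy, colG_eq g j z hz] at e
    rw [e]; exact hz
  rcases le_total i i' with hle | hle
  · exact ⟨g, key f g i i' h1 h1' h hle, le_rfl⟩
  · exact ⟨f, le_rfl, key g f i' i h1' h1 (fun j hj => (h j (by rwa [min_comm])).symm) hle⟩

theorem collapse_main {K : Type 1} [Preorder K] [Nonempty K] {M : Cardinal.{1}}
    {T : Ordinal.{0} → Set K}
    (hσ : SigmaClosed K) (hM : Cardinal.aleph 1 ≤ M) (hT : BaseMatrix K M T)
    (lam : Cardinal.{0}) (hlam : Cardinal.lift.{1} lam = M ^ ℵ₀) (hK : #K ≤ M ^ ℵ₀)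
    {B : Type 1} [CompleteBooleanAlgebra B] (E : K → B)
    (E2 : ∀ d d', ¬ Cmp d d' → E d ⊓ E d' = ⊥) (E3 : ∀ d, E d ≠ ⊥)
    (E4 : ∀ b : B, b ≠ ⊥ → ∃ d, ∀ d' ≤ d, E d' ⊓ b ≠ ⊥) :
    ∃ ι : Col lam → B, (∀ f, ι f ≠ ⊥) ∧
      (∀ f g, (¬ ∃ r, r ≤ f ∧ r ≤ g) → ι f ⊓ ι g = ⊥) ∧
      (∀ Δ : Set (Col lam), (∀ f g, f ≤ g → g ∈ Δ → f ∈ Δ) → (∀ f, ∃ g, g ≤ f ∧ g ∈ Δ) →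
        sSup (ι '' Δ) = ⊤) := by
  classical
  have hm : ∀ i : Ordinal.{0}, ∃ m : K → K,
      (∀ k ∈ {k | M ^ ℵ₀ ≤ #{t | t ∈ T i ∧ Cmp k t}}, m k ∈ {t | t ∈ T i ∧ Cmp k t}) ∧
      ∀ k ∈ {k | M ^ ℵ₀ ≤ #{t | t ∈ T i ∧ Cmp k t}},
      ∀ k' ∈ {k | M ^ ℵ₀ ≤ #{t | t ∈ T i ∧ Cmp k t}}, m k = m k' → k = k' :=
    fun i => transversal hK _ _ fun k hk => hk
  choose m hm1 hm2 using hm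
  have hp := pick_exists hσ hM hT lam hlam hK m (fun i k hk => hm1 i k hk)
    (fun i k k' hk hk' h => hm2 i k hk k' hk' h)
  have hp' : ∀ (i : Ordinal.{0}) (N : Set K), ∃ P : Ordinal.{0} → K,
      (i < W1 → Opn N → N.Nonempty →
      (∀ ξ < lam.ord, P ξ ∈ N) ∧
      (∀ ξ < lam.ord, ∃ t ∈ T i, P ξ ≤ t) ∧
      (∀ ξ < lam.ord, ∀ ξ' < lam.ord, Cmp (P ξ) (P ξ') → ξ = ξ') ∧
      (∀ d ∈ N, ∃ ξ < lam.ord, Cmp d (P ξ)) ∧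
      (∀ ξ < lam.ord, ∀ k, M ^ ℵ₀ ≤ #{t | t ∈ T i ∧ Cmp k t} → P ξ ≤ m i k →
        P ξ ≤ k ∨ ¬ Cmp (P ξ) k)) := by
    intro i N
    by_cases h : i < W1 ∧ Opn N ∧ N.Nonempty
    · obtain ⟨P, hP⟩ := hp i h.1 N h.2.1 h.2.2
      exact ⟨P, fun _ _ _ => hP⟩
    · exact ⟨fun _ => Classical.arbitrary K, fun h1 h2 h3 => absurd ⟨h1, h2, h3⟩ h⟩
  choose pick hpick using hp'
  have hL : 0 < lam.ord := by
    rw [Cardinal.lt_ord]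
    simp only [Ordinal.card_zero]
    rw [pos_iff_ne_zero]
    rintro rfl
    rw [Cardinal.lift_zero] at hlam
    have : M ^ ℵ₀ ≠ 0 := by
      apply Cardinal.power_ne_zero
      rintro rfl
      exact absurd hM (not_le.2 (Cardinal.aleph_pos 1))
    exact this hlam.symm
  have hmem : ∀ i < W1, ∀ N : Set K, Opn N → N.Nonempty → ∀ ξ < lam.ord, pick i N ξ ∈ N :=
    fun i hi N h1 h2 => (hpick i N hi h1 h2).1
  have hinj := fun i hi N h1 h2 => (hpick i N hi h1 h2).2.2.1
  have hpre := fun i hi N h1 h2 => (hpick i N hi h1 h2).2.2.2.1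
  -- the guessing property
  have hguess : ∀ k : K, ∃ i < W1, ∃ g : Ordinal.{0} → Ordinal.{0}, (∀ j, g j < lam.ord) ∧
      treeD pick g i ≤ k := by
    intro k
    obtain ⟨i, hi, hk⟩ := big_level hσ hM hT k
    obtain ⟨hmk1, d, hd1, hd2⟩ := hm1 i k hk
    obtain ⟨g, hg, d', hd', hN⟩ := tree_dense hσ lam.ord pick hmem hinj hpre hL (i + 1)
      (W1_succ hi) d
    have hne := (treeN_nonempty hσ lam.ord pick hmem g hg i hi).1
    have hle : d' ≤ treeD pick g i := hN i (by simp)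
    have hs := hpick i _ hi (treeN_opn pick g i) hne
    obtain ⟨t, ht, hle2⟩ := hs.2.1 (g i) (hg i)
    have hs5 := hs.2.2.2.2 (g i) (hg i) k hk
    rw [← treeD_eq pick g i] at hle2 hs5
    have e : t = m i k := hT.anti i hi _ ht _ hmk1 ⟨d', hle.trans hle2, hd'.trans hd2⟩
    refine ⟨i, hi, g, hg, ?_⟩
    rcases hs5 (e ▸ hle2) with h | h
    · exact h
    · exact absurd ⟨d', hle, hd'.trans hd1⟩ h
  let N : Col lam → Set K := fun f => {d | ∀ j, (f.1 j).isSome → d ≤ treeD pick (colG f) j}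
  have hNeq : ∀ (f : Col lam) i, (∀ j, (f.1 j).isSome ↔ j < i) → N f = treeN pick (colG f) i := by
    intro f i hi
    ext d
    exact forall_congr' fun j => by rw [hi j]
  have hNne : ∀ f, (N f).Nonempty := by
    intro f
    obtain ⟨i, hi, h1, h2⟩ := f.2
    rw [hNeq f i h1]
    exact (treeN_nonempty hσ lam.ord pick hmem _ (colG_lt hL f) i hi).1
  refine ⟨fun f => sSup (E '' N f), ?_, ?_, ?_⟩
  · intro f h
    obtain ⟨d, hd⟩ := hNne f
    exact E3 d (le_bot_iff.1 (h ▸ le_sSup ⟨d, hd, rfl⟩))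
  · intro f g hfg
    apply le_bot_iff.1
    rw [sSup_inf_eq]
    refine iSup₂_le ?_
    rintro _ ⟨d, hd, rfl⟩
    rw [inf_sSup_eq]
    refine iSup₂_le ?_
    rintro _ ⟨d', hd', rfl⟩
    apply le_of_eq
    apply E2
    rintro ⟨r, hr1, hr2⟩
    apply hfg
    obtain ⟨i, hi, h1, h2⟩ := f.2
    obtain ⟨i', hi', h1', h2'⟩ := g.2
    rw [hNeq f i h1] at hd
    rw [hNeq g i' h1'] at hd'
    apply col_compat f g i i' h1 h1'
    exact tree_unique hσ lam.ord pick hmem hinj _ _ (colG_lt hL f) (colG_lt hL g) (min i i')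
      ((min_le_left _ _).trans hi.le) r
      (fun j hj => hr1.trans (hd j (hj.trans_le (min_le_left _ _))))
      (fun j hj => hr2.trans (hd' j (hj.trans_le (min_le_right _ _))))
  · intro Δ hopen hdense
    by_contra hne
    have hb : (sSup ((fun f => sSup (E '' N f)) '' Δ))ᶜ ≠ ⊥ := by
      intro h; exact hne (compl_eq_bot.1 h)
    obtain ⟨d, hd⟩ := E4 _ hb
    obtain ⟨i, hi, g, hg, hle⟩ := hguess d
    let f : Col lam := ⟨fun j => if j < i + 1 then some (g j) else none, i + 1, W1_succ hi, by
      intro j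
      by_cases h : j < i + 1
      · simp only [h, if_true, Option.isSome_some]
      · simp only [h, if_false, Option.isSome_none]
        simp, by
      intro j y h
      by_cases h' : j < i + 1
      · simp only [h', if_true, Option.some.injEq] at h
        exact h ▸ hg j
      · simp only [h', if_false] at h
        cases h⟩
    obtain ⟨f', hf', hΔ⟩ := hdense f
    obtain ⟨d', hd'⟩ := hNne f'
    have hval : ∀ j < i + 1, f'.1 j = some (g j) := by
      intro j hj
      apply hf' j (g j)
      show (if j < i + 1 then some (g j) else none) = some (g j)
      rw [if_pos hj]
    have e : treeD pick (colG f') i = treeD pick g i := by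
      apply treeD_congr
      intro j hj
      exact colG_eq f' j _ (hval j (Order.lt_add_one_iff.2 hj))
    have h1 : d' ≤ d := by
      refine le_trans ?_ hle
      rw [← e]
      apply hd'
      rw [hval i (by simp)]; rfl
    apply hd d' h1
    have h2 : E d' ≤ sSup ((fun f => sSup (E '' N f)) '' Δ) :=
      (le_sSup ⟨d', hd', rfl⟩ : E d' ≤ sSup (E '' N f')).trans (le_sSup ⟨f', hΔ, rfl⟩)
    exact disjoint_iff.1 (disjoint_compl_right.mono_left h2)

/-- `χ` has cofinality at least `θ`. -/
def CG (θ : Cardinal.{1}) (χ : Ordinal.{0}) : Prop :=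
  ∀ A : Set Ordinal.{0}, A ⊆ Iio χ → #A < θ → ∃ b < χ, ∀ a ∈ A, a < b

/-- `A` is unbounded in `χ`. -/
def Unb (A : Set Ordinal.{0}) (χ : Ordinal.{0}) : Prop := ∀ b < χ, ∃ x ∈ A, b < x ∧ x < χ

/-- `A` contains all its accumulation points below `χ`. -/
def ClosedIn (A : Set Ordinal.{0}) (χ : Ordinal.{0}) : Prop := ∀ α < χ, α ≠ 0 → Unb A α → α ∈ A

/-- `A` contains all its accumulation points. -/
def AccClosed (A : Set Ordinal.{0}) : Prop := ∀ α, α ≠ 0 → Unb A α → α ∈ A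

theorem Unb.mono {A B : Set Ordinal.{0}} {χ : Ordinal.{0}} (h : Unb A χ) (hAB : A ⊆ B) :
    Unb B χ := by
  intro b hb
  obtain ⟨x, hx, h1⟩ := h b hb
  exact ⟨x, hAB hx, h1⟩

theorem CG.pos {θ : Cardinal.{1}} {χ : Ordinal.{0}} (h : CG θ χ) (hθ : ℵ₀ ≤ θ) : 0 < χ := by
  obtain ⟨b, hb, _⟩ := h ∅ (by simp) (by simpa using Cardinal.aleph0_pos.trans_le hθ)
  exact (zero_le).trans_lt hb

theorem card_Iic_lt {θ : Cardinal.{1}} (hθ : ℵ₀ ≤ θ) {q : Set Ordinal.{0}} {a : Ordinal.{0}}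
    (h : #(q ∩ Iio a : Set Ordinal.{0}) < θ) : #(q ∩ Iic a : Set Ordinal.{0}) < θ := by
  have : (q ∩ Iic a : Set Ordinal.{0}) ⊆ (q ∩ Iio a) ∪ {a} := by
    rintro x ⟨h1, h2⟩
    rcases eq_or_lt_of_le (mem_Iic.1 h2) with h | h
    · exact Or.inr h
    · exact Or.inl ⟨h1, h⟩
  refine (Cardinal.mk_le_mk_of_subset this).trans_lt ((Cardinal.mk_union_le _ _).trans_lt ?_)
  apply Cardinal.add_lt_of_lt hθ h
  simpa using Cardinal.one_lt_aleph0.trans_le hθ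

theorem first_lemma {θ : Cardinal.{1}} (hθ : θ.IsRegular) {q : Set Ordinal.{0}} {o : Ordinal.{0}}
    (hqo : q ⊆ Iio o) (hq : θ < #q) :
    ∃ χ, CG θ χ ∧ Unb q χ ∧ #(q ∩ Iio χ : Set Ordinal.{0}) ≤ θ ∧ ∃ x ∈ q, χ ≤ x := by
  have hθ0 := hθ.aleph0_le
  let S : Set Ordinal.{0} := {χ | θ ≤ #(q ∩ Iio χ : Set Ordinal.{0})}
  have hS : S.Nonempty := ⟨o, by
    show θ ≤ _
    rw [inter_eq_left.2 hqo]; exact hq.le⟩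
  let χ := sInf S
  have hχ : θ ≤ #(q ∩ Iio χ : Set Ordinal.{0}) := csInf_mem hS
  have hmin : ∀ b < χ, #(q ∩ Iic b : Set Ordinal.{0}) < θ := by
    intro b hb
    apply card_Iic_lt hθ0
    by_contra! h
    exact absurd (csInf_le' (s := S) h) (not_le.2 hb)
  have hle : #(q ∩ Iio χ : Set Ordinal.{0}) ≤ θ := by
    obtain ⟨Y, hY, hYc⟩ := Cardinal.le_mk_iff_exists_subset.1 hχ
    have : (q ∩ Iio χ : Set Ordinal.{0}) ⊆ ⋃ y ∈ Y, q ∩ Iic y := by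
      rintro x ⟨hx1, hx2⟩
      by_contra hcon
      have : Y ⊆ q ∩ Iic x := by
        intro y hy
        refine ⟨(hY hy).1, ?_⟩
        by_contra! hxy
        have hxy : x < y := not_le.1 hxy
        exact hcon (mem_biUnion hy ⟨hx1, hxy.le⟩)
      have h1 := Cardinal.mk_le_mk_of_subset this
      rw [hYc] at h1
      exact absurd h1 (not_le.2 (hmin x hx2))
    refine (Cardinal.mk_le_mk_of_subset this).trans ?_
    apply card_biUnion_le hθ0 _ _ hYc.le
    intro y hy
    exact (hmin y (hY hy).2).le
  refine ⟨χ, ?_, ?_, hle, ?_⟩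
  · intro A hA hAc
    by_contra! hcon
    have : (q ∩ Iio χ : Set Ordinal.{0}) ⊆ ⋃ y ∈ A, q ∩ Iic y := by
      rintro x ⟨hx1, hx2⟩
      obtain ⟨y, hy, h⟩ := hcon x hx2
      exact mem_biUnion hy ⟨hx1, h⟩
    have h2 : #(⋃ y ∈ A, q ∩ Iic y : Set Ordinal.{0}) < θ := by
      rw [Cardinal.card_biUnion_lt_iff_forall_of_isRegular hθ hAc]
      intro y hy
      exact hmin y (hA hy)
    exact absurd ((hχ.trans (Cardinal.mk_le_mk_of_subset this))) (not_le.2 h2)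
  · intro b hb
    by_contra! hcon
    have : (q ∩ Iio χ : Set Ordinal.{0}) ⊆ q ∩ Iic b := by
      rintro x ⟨hx1, hx2⟩
      refine ⟨hx1, ?_⟩
      by_contra! h
      exact absurd hx2 (not_lt.2 (hcon x hx1 (not_le.1 h)))
    exact absurd (hχ.trans (Cardinal.mk_le_mk_of_subset this)) (not_le.2 (hmin b hb))
  · by_contra! hcon
    have : q ⊆ q ∩ Iio χ := fun x hx => ⟨hx, hcon x hx⟩
    exact absurd ((Cardinal.mk_le_mk_of_subset this).trans hle) (not_le.2 hq)

theorem club_inter {θ : Cardinal.{1}} (hθ : ℵ₀ < θ) {χ : Ordinal.{0}} (hχ : CG θ χ)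
    (F : Set (Set Ordinal.{0})) (hF : #F < θ) (hcl : ∀ t ∈ F, ClosedIn t χ)
    (hunb : ∀ t ∈ F, Unb t χ) : ClosedIn (⋂₀ F) χ ∧ Unb (⋂₀ F) χ := by
  constructor
  · intro α hα h0 h t ht
    exact hcl t ht α hα h0 (h.mono (sInter_subset_of_mem ht))
  · have hstep : ∀ b : Iio χ, ∃ b' : Iio χ, b < b' ∧ ∀ t ∈ F, ∃ x ∈ t, b.1 < x ∧ x < b'.1 := by
      rintro ⟨b, hb⟩
      have h1 : ∀ t ∈ F, ∃ x ∈ t, b < x ∧ x < χ := fun t ht => hunb t ht b hb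
      choose! x hx1 hx2 hx3 using h1
      obtain ⟨b1, hb1, h1⟩ := hχ (x '' F) (by rintro _ ⟨t, ht, rfl⟩; exact hx3 t ht)
        (Cardinal.mk_image_le.trans_lt hF)
      obtain ⟨b2, hb2, h2⟩ := hχ {b} (by simpa using hb)
        (by simpa using Cardinal.one_lt_aleph0.trans hθ)
      refine ⟨⟨max b1 b2, max_lt hb1 hb2⟩, (h2 b rfl).trans_le (le_max_right _ _), ?_⟩
      intro t ht
      exact ⟨x t, hx1 t ht, hx2 t ht, (h1 _ ⟨t, ht, rfl⟩).trans_le (le_max_left _ _)⟩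
    choose s hs1 hs2 using hstep
    intro b hb
    let c : ℕ → Iio χ := fun n => Nat.rec ⟨b, hb⟩ (fun _ x => s x) n
    have hc0 : (c 0).1 = b := rfl
    obtain ⟨b', hb', hbound⟩ := hχ (range fun n => (c n).1)
      (by rintro _ ⟨n, rfl⟩; exact (c n).2)
      ((Cardinal.le_aleph0_iff_set_countable.2 (countable_range _)).trans_lt hθ)
    let α := ⨆ n, (c n).1
    have hle : ∀ n, (c n).1 ≤ α := fun n => Ordinal.le_iSup (fun n => (c n).1) n
    have hαχ : α < χ := by
      refine lt_of_le_of_lt ?_ hb'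
      exact Ordinal.iSup_le fun n => (hbound _ ⟨n, rfl⟩).le
    have hbα : b < α := lt_of_lt_of_le (hs1 (c 0)) (hle 1)
    refine ⟨α, ?_, hbα, hαχ⟩
    intro t ht
    refine hcl t ht α hαχ ((zero_le).trans_lt hbα).ne' ?_
    intro β hβ
    obtain ⟨n, hn⟩ := Ordinal.lt_iSup_iff.1 hβ
    obtain ⟨x, hx, h1, h2⟩ := hs2 (c n) t ht
    exact ⟨x, hx, hn.trans h1, h2.trans_le (hle (n + 1))⟩

/-- Adding all accumulation points. -/
def clos (A : Set Ordinal.{0}) : Set Ordinal.{0} := A ∪ {α | α ≠ 0 ∧ Unb A α}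

theorem clos_acc (A : Set Ordinal.{0}) : AccClosed (clos A) := by
  intro α h0 h
  right
  refine ⟨h0, fun b hb => ?_⟩
  obtain ⟨x, hx, h1, h2⟩ := h b hb
  rcases hx with hx | ⟨_, hx⟩
  · exact ⟨x, hx, h1, h2⟩
  · obtain ⟨y, hy, h3, h4⟩ := hx b h1
    exact ⟨y, hy, h3, h4.trans h2⟩

theorem clos_Iic {A : Set Ordinal.{0}} {δ : Ordinal.{0}} (h : A ⊆ Iic δ) : clos A ⊆ Iic δ := by
  rintro x (hx | ⟨_, hx⟩)
  · exact h hx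
  · by_contra! hcon
    obtain ⟨y, hy, h3, h4⟩ := hx δ (not_le.1 hcon)
    exact absurd (h hy) (not_le.2 h3)

theorem sSup_mem_closed {E : Set Ordinal.{0}} {χ α : Ordinal.{0}} (hE : ClosedIn E χ) (hα : α < χ)
    (h0 : sSup (E ∩ Iic α) ≠ 0) : sSup (E ∩ Iic α) ∈ E := by
  have hbdd : BddAbove (E ∩ Iic α) := ⟨α, fun x hx => hx.2⟩
  have hne : (E ∩ Iic α).Nonempty := by
    by_contra h
    rw [not_nonempty_iff_eq_empty] at h
    rw [h] at h0; simp at h0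
  by_cases hmem : sSup (E ∩ Iic α) ∈ E ∩ Iic α
  · exact hmem.1
  · have hle : sSup (E ∩ Iic α) ≤ α := csSup_le hne fun x hx => hx.2
    apply hE _ (hle.trans_lt hα) h0
    intro b hb
    obtain ⟨x, hx, hbx⟩ := exists_lt_of_lt_csSup hne hb
    refine ⟨x, hx.1, hbx, lt_of_le_of_ne (le_csSup hbdd hx) ?_⟩
    rintro h
    exact hmem (h ▸ hx)

/-- One step of the club guessing construction. -/
def guessPre (e : Ordinal.{0} → Set Ordinal.{0}) (E : Set Ordinal.{0}) (δ : Ordinal.{0}) :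
    Set Ordinal.{0} :=
  {x | x ≠ 0 ∧ ∃ α ∈ e δ, x = sSup (E ∩ Iic α)}

theorem bdd_ToType {κ : Cardinal.{1}} (hκ : ℵ₀ ≤ κ) (A : Set (Order.succ κ).ord.ToType)
    (hA : #A ≤ κ) : ∃ i, ∀ a ∈ A, a < i := by
  by_contra! hcon
  have h1 : (univ : Set (Order.succ κ).ord.ToType) ⊆ ⋃ a ∈ A, Iic a := by
    intro i _
    obtain ⟨a, ha, h⟩ := hcon i
    exact mem_biUnion ha h
  have h2 : #(⋃ a ∈ A, Iic a : Set (Order.succ κ).ord.ToType) ≤ κ := by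
    apply card_biUnion_le hκ _ _ hA
    intro a _
    have h3 : #(Iio a) < #(Order.succ κ).ord.ToType := Cardinal.mk_Iio_lt a (by simp)
    rw [Cardinal.mk_ord_toType, Order.lt_succ_iff] at h3
    rw [← Iio_insert]
    refine (Cardinal.mk_insert_le).trans ?_
    exact Cardinal.add_le_of_le hκ h3 (Cardinal.one_le_aleph0.trans hκ)
  have h3 := (Cardinal.mk_le_mk_of_subset h1).trans h2
  rw [Cardinal.mk_univ, Cardinal.mk_ord_toType] at h3
  exact absurd h3 (not_le.2 (Order.lt_succ κ))

theorem club_guess {κ : Cardinal.{1}} (hκ : κ.IsRegular) {χ : Ordinal.{0}}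
    (hχ : CG (Order.succ (Order.succ κ)) χ) :
    ∃ c : Ordinal.{0} → Set Ordinal.{0}, ∀ E, ClosedIn E χ → Unb E χ →
      ∃ δ < χ, c δ ⊆ E ∧ κ ≤ #(c δ) ∧ AccClosed (c δ) ∧ c δ ⊆ Iic δ := by
  classical
  by_contra! hcon
  have hκ0 := hκ.aleph0_le
  have hκ1 : κ < Order.succ κ := Order.lt_succ κ
  have hκ2 : Order.succ κ < Order.succ (Order.succ κ) := Order.lt_succ _
  have hθ : ℵ₀ < Order.succ (Order.succ κ) := hκ0.trans_lt (hκ1.trans hκ2)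
  -- ladder system
  have he : ∀ δ : Ordinal.{0}, ∃ e : Set Ordinal.{0}, e ⊆ Iio δ ∧ #e ≤ κ ∧
      ((∃ e' : Set Ordinal.{0}, e' ⊆ Iio δ ∧ #e' ≤ κ ∧ Unb e' δ) → Unb e δ) := by
    intro δ
    by_cases h : ∃ e' : Set Ordinal.{0}, e' ⊆ Iio δ ∧ #e' ≤ κ ∧ Unb e' δ
    · obtain ⟨e, h1, h2, h3⟩ := h
      exact ⟨e, h1, h2, fun _ => h3⟩
    · exact ⟨∅, by simp, by simp, fun h' => absurd h' h⟩
  choose e he1 he2 he3 using he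
  have hφ : ∀ E : Set Ordinal.{0}, ∃ E' : Set Ordinal.{0}, ClosedIn E' χ ∧ Unb E' χ ∧
      ∀ δ < χ, clos (guessPre e E δ) ⊆ E' → ¬ κ ≤ #(clos (guessPre e E δ)) := by
    intro E
    obtain ⟨E', h1, h2, h3⟩ := hcon (fun δ => clos (guessPre e E δ))
    refine ⟨E', h1, h2, fun δ hδ h4 h5 => h3 δ hδ h4 h5 (clos_acc _) ?_⟩
    apply clos_Iic
    rintro x ⟨_, α, hα, rfl⟩
    have hαδ : α < δ := he1 δ hα
    rcases (E ∩ Iic α).eq_empty_or_nonempty with h | h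
    · rw [h]; simp
    · exact (csSup_le h fun x hx => hx.2).trans hαδ.le
  choose φ hφ1 hφ2 hφ3 using hφ
  let W := (Order.succ κ).ord.ToType
  have hWc : #W = Order.succ κ := Cardinal.mk_ord_toType _
  let G : ∀ i : W, (∀ j : W, j < i → Set Ordinal.{0}) → Set Ordinal.{0} :=
    fun i f => ⋂₀ {t | ∃ j, ∃ h : j < i, t = φ (f j h)}
  let E : W → Set Ordinal.{0} := (wellFounded_lt (α := W)).fix G
  have hE : ∀ i, E i = ⋂₀ {t | ∃ j, ∃ _ : j < i, t = φ (E j)} :=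
    fun i => (wellFounded_lt (α := W)).fix_eq G i
  have hEsub : ∀ i j, j < i → E i ⊆ φ (E j) := by
    intro i j h
    rw [hE i]
    exact sInter_subset_of_mem ⟨j, h, rfl⟩
  have hEanti : ∀ i j, i ≤ j → E j ⊆ E i := by
    intro i j h
    rw [hE i, hE j]
    apply sInter_subset_sInter
    rintro t ⟨k, hk, rfl⟩
    exact ⟨k, hk.trans_le h, rfl⟩
  have hEcl : ∀ i, ClosedIn (E i) χ := by
    intro i
    rw [hE i]
    intro α hα h0 h t ht
    obtain ⟨j, hj, rfl⟩ := id ht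
    exact hφ1 _ α hα h0 (h.mono (sInter_subset_of_mem ht))
  obtain ⟨hIcl, hIunb⟩ := club_inter hθ hχ (range fun i : W => φ (E i))
    (Cardinal.mk_range_le.trans_lt (by rw [hWc]; exact hκ2))
    (by rintro _ ⟨i, rfl⟩; exact hφ1 _) (by rintro _ ⟨i, rfl⟩; exact hφ2 _)
  set I := ⋂₀ (range fun i : W => φ (E i)) with hI
  have hIE : ∀ i, I ⊆ E i := by
    intro i
    rw [hE i]
    rintro x hx t ⟨j, hj, rfl⟩
    exact hx _ ⟨j, rfl⟩
  have hIcard : κ < #(I ∩ Iio χ : Set Ordinal.{0}) := by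
    by_contra! h
    obtain ⟨b, hb, hb'⟩ := hχ (I ∩ Iio χ) inter_subset_right (h.trans_lt (hκ1.trans hκ2))
    obtain ⟨x, hx, h1, h2⟩ := hIunb b hb
    exact absurd (hb' x ⟨hx, h2⟩) (not_lt.2 h1.le)
  obtain ⟨δ, hδ1, hδ2, hδ3, x, hx, hδx⟩ := first_lemma hκ inter_subset_right hIcard
  have hδχ : δ < χ := hδx.trans_lt hx.2
  have heδ : Unb (e δ) δ := he3 δ ⟨(I ∩ Iio χ) ∩ Iio δ, inter_subset_right, hδ3, by
    intro b hb
    obtain ⟨y, hy, h1, h2⟩ := hδ2 b hb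
    exact ⟨y, ⟨hy, h2⟩, h1, h2⟩⟩
  -- stabilisation
  have hmono : ∀ i j α, i ≤ j → sSup (E j ∩ Iic α) ≤ sSup (E i ∩ Iic α) := by
    intro i j α hij
    rcases (E j ∩ Iic α).eq_empty_or_nonempty with h | h
    · rw [h]; simp
    · exact csSup_le_csSup ⟨α, fun x hx => hx.2⟩ h
        (inter_subset_inter_left _ (hEanti i j hij))
  obtain ⟨i00, _⟩ := bdd_ToType hκ0 (∅ : Set W) (by simp)
  have hstab : ∀ α : Ordinal.{0}, ∃ i0 : W, ∀ i, i0 ≤ i →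
      sSup (E i ∩ Iic α) = sSup (E i0 ∩ Iic α) := by
    intro α
    have hne : (range fun i : W => sSup (E i ∩ Iic α)).Nonempty := ⟨_, i00, rfl⟩
    obtain ⟨i0, hi0⟩ := csInf_mem hne
    refine ⟨i0, fun i hi => le_antisymm (hmono _ _ _ hi) ?_⟩
    simp only at hi0
    rw [hi0]
    exact csInf_le' ⟨i, rfl⟩
  choose st hst using hstab
  obtain ⟨i1, hi1⟩ := bdd_ToType hκ0 (st '' e δ) (Cardinal.mk_image_le.trans (he2 δ))
  obtain ⟨i2, hi2⟩ := bdd_ToType hκ0 {i1} (by simpa using Cardinal.one_le_aleph0.trans hκ0)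
  have hi12 : i1 < i2 := hi2 i1 rfl
  have hsub : guessPre e (E i1) δ ⊆ φ (E i1) := by
    rintro x ⟨hx0, α, hα, rfl⟩
    have h1 := (hi1 _ ⟨α, hα, rfl⟩).le
    have e1 : sSup (E i1 ∩ Iic α) = sSup (E i2 ∩ Iic α) := by
      rw [hst α i1 h1, hst α i2 (h1.trans hi12.le)]
    rw [e1] at hx0 ⊢
    have hαδ : α < δ := he1 δ hα
    exact hEsub i2 i1 hi12 (sSup_mem_closed (hEcl i2) (hαδ.trans hδχ) hx0)
  have hlt : guessPre e (E i1) δ ⊆ Iio δ := by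
    rintro x ⟨hx0, α, hα, rfl⟩
    have hαδ : α < δ := he1 δ hα
    rcases (E i1 ∩ Iic α).eq_empty_or_nonempty with h | h
    · rw [h] at hx0; simp at hx0
    · exact (csSup_le h fun x hx => hx.2).trans_lt hαδ
  refine hφ3 (E i1) δ hδχ ?_ ?_
  · rintro x (hx | ⟨hx0, hx⟩)
    · exact hsub hx
    · have hxδ : x ≤ δ := by
        have := clos_Iic (δ := δ) (hlt.trans Iio_subset_Iic_self)
        exact this (Or.inr ⟨hx0, hx⟩)
      exact hφ1 _ x (hxδ.trans_lt hδχ) hx0 (hx.mono hsub)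
  · by_contra! h
    obtain ⟨b, hb, hb'⟩ := hδ1 (guessPre e (E i1) δ) hlt
      ((Cardinal.mk_le_mk_of_subset subset_union_left).trans_lt h)
    obtain ⟨y, hy, hy1, hy2⟩ := hδ2 b hb
    obtain ⟨α, hα, h1, h2⟩ := heδ y hy2
    have hle : y ≤ sSup (E i1 ∩ Iic α) :=
      le_csSup ⟨α, fun x hx => hx.2⟩ ⟨hIE i1 hy.1, h1.le⟩
    have := hb' (sSup (E i1 ∩ Iic α)) ⟨((zero_le).trans_lt (hy1.trans_le hle)).ne', α, hα, rfl⟩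
    exact absurd this (not_lt.2 (hy1.le.trans hle))

/-- The parameters attached to a singular cardinal of countable cofinality. -/
structure Par (o : Ordinal.{0}) (M : Cardinal.{1}) (a : ℕ → Ordinal.{0}) (κ : ℕ → Cardinal.{1}) :
    Prop where
  a_lt : ∀ k, a k < o
  a_mono : Monotone a
  a_cof : ∀ b < o, ∃ k, b < a k
  reg : ∀ k, (κ k).IsRegular
  unc : ∀ k, Cardinal.aleph 1 ≤ κ k
  ini : ∀ k, #(Iio (a k)) ≤ κ k
  lt : ∀ k, κ k < M
  mono : Monotone κ
  lim : ∀ c < M, Order.succ c < M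
  sup : ∀ N : Cardinal.{1}, (∀ k, κ k ≤ N) → M ≤ N
  card_o : #(Iio o) = M
  card_b : ∀ b < o, #(Iio b) < M

namespace Par

variable {o : Ordinal.{0}} {M : Cardinal.{1}} {a : ℕ → Ordinal.{0}} {κ : ℕ → Cardinal.{1}}

theorem M_unc (P : Par o M a κ) : Cardinal.aleph 1 ≤ M := (P.unc 0).trans (P.lt 0).le

theorem M_inf (P : Par o M a κ) : ℵ₀ ≤ M := (Cardinal.aleph0_le_aleph 1).trans P.M_unc

theorem o_succ (P : Par o M a κ) {b : Ordinal.{0}} (hb : b < o) : b + 1 < o := by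
  obtain ⟨k, hk⟩ := P.a_cof b hb
  have : b + 1 ≤ a k := Order.add_one_le_iff.2 hk
  exact this.trans_lt (P.a_lt k)

theorem card_Iic (P : Par o M a κ) {b : Ordinal.{0}} (hb : b < o) : #(Iic b) < M := by
  have := P.card_b _ (P.o_succ hb)
  refine lt_of_le_of_lt (Cardinal.mk_le_mk_of_subset ?_) this
  intro x hx
  exact Order.lt_add_one_iff.2 (mem_Iic.1 hx)

end Par

/-- Closed subsets of `o` of full size. -/
def QS (o : Ordinal.{0}) (M : Cardinal.{1}) (A : Set Ordinal.{0}) : Prop :=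
  A ⊆ Iio o ∧ ClosedIn A o ∧ #A = M

theorem QS_tail {o : Ordinal.{0}} {M : Cardinal.{1}} {a : ℕ → Ordinal.{0}} {κ : ℕ → Cardinal.{1}}
    (P : Par o M a κ) {A : Set Ordinal.{0}} (hA : #A = M) {b : Ordinal.{0}} (hb : b < o)
    {c : Cardinal.{1}} (hc : c < M) : c < #(A ∩ Ioi b : Set Ordinal.{0}) := by
  by_contra! h
  have : A ⊆ Iic b ∪ (A ∩ Ioi b) := by
    intro x hx
    rcases le_or_gt x b with h | h
    · exact Or.inl h
    · exact Or.inr ⟨hx, h⟩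
  have h1 := (Cardinal.mk_le_mk_of_subset this).trans (Cardinal.mk_union_le _ _)
  have h2 : #(Iic b) + #(A ∩ Ioi b : Set Ordinal.{0}) < M :=
    Cardinal.add_lt_of_lt P.M_inf (P.card_Iic hb) (h.trans_lt hc)
  rw [hA] at h1
  exact absurd h1 (not_le.2 h2)

theorem homog_lemma {o : Ordinal.{0}} {M : Cardinal.{1}} {a : ℕ → Ordinal.{0}}
    {κ : ℕ → Cardinal.{1}} (P : Par o M a κ) :
    ∃ 𝒢 : Set (Set Ordinal.{0}), #𝒢 ≤ M ∧ ∀ (k : ℕ) (q : Set Ordinal.{0}), QS o M q →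
      ∀ 𝒱 : Set (Set Ordinal.{0}), #𝒱 ≤ κ k → (∀ t ∈ 𝒱, ClosedIn t o) → ∀ β < o,
      ∃ c ∈ 𝒢, c ⊆ q ∧ (∀ x ∈ c, β < x) ∧ κ k ≤ #c ∧ AccClosed c ∧ (∃ δ < o, c ⊆ Iic δ) ∧
        ∀ t ∈ 𝒱, c ⊆ t ∨ Disjoint c t := by
  classical
  have hc : ∀ (k : ℕ) (χ : Ordinal.{0}), ∃ c : Ordinal.{0} → Set Ordinal.{0},
      CG (Order.succ (Order.succ (κ k))) χ → ∀ E, ClosedIn E χ → Unb E χ →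
      ∃ δ < χ, c δ ⊆ E ∧ κ k ≤ #(c δ) ∧ AccClosed (c δ) ∧ c δ ⊆ Iic δ := by
    intro k χ
    by_cases h : CG (Order.succ (Order.succ (κ k))) χ
    · obtain ⟨c, hc⟩ := club_guess (P.reg k) h
      exact ⟨c, fun _ => hc⟩
    · exact ⟨fun _ => ∅, fun h' => absurd h' h⟩
  choose c hc using hc
  refine ⟨⋃ χ ∈ Iio o, ⋃ δ ∈ Iio o, range fun k => c k χ δ, ?_, ?_⟩
  · apply card_biUnion_le P.M_inf _ _ P.card_o.le
    intro χ _
    apply card_biUnion_le P.M_inf _ _ P.card_o.le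
    intro δ _
    exact (Cardinal.le_aleph0_iff_set_countable.2 (countable_range _)).trans P.M_inf
  · intro k q hq 𝒱 h𝒱 hcl β hβ
    set θ := Order.succ (Order.succ (κ k)) with hθdef
    have hκ0 := (P.reg k).aleph0_le
    have hκ1 : κ k < Order.succ (κ k) := Order.lt_succ _
    have hκθ : κ k < θ := hκ1.trans (Order.lt_succ _)
    have hθ0 : ℵ₀ < θ := hκ0.trans_lt hκθ
    have hθ : θ.IsRegular := Cardinal.isRegular_succ (hκ0.trans hκ1.le)
    have hθM : θ < M := P.lim _ (P.lim _ (P.lt k))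
    obtain ⟨χ, hχ, hunb, _, x, hx, hχx⟩ := first_lemma (o := o) hθ
      (inter_subset_left.trans hq.1) (QS_tail P hq.2.2 hβ hθM)
    have hχo : χ < o := hχx.trans_lt (hq.1 hx.1)
    have hβχ : β < χ := by
      obtain ⟨y, hy, _, h2⟩ := hunb 0 (hχ.pos hθ0.le)
      exact lt_trans hy.2 h2
    have hb : ∀ t : Set Ordinal.{0}, ∃ b < χ, ¬ Unb t χ → ∀ x ∈ t, b < x → χ ≤ x := by
      intro t
      by_cases h : Unb t χ
      · exact ⟨β, hβχ, fun h' => absurd h h'⟩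
      · have h' := h
        unfold Unb at h
        push Not at h
        obtain ⟨b, hb, h1⟩ := h
        exact ⟨b, hb, fun _ => h1⟩
    choose b hb1 hb2 using hb
    obtain ⟨bs, hbs, hbs'⟩ := hχ (b '' 𝒱) (by rintro _ ⟨t, _, rfl⟩; exact hb1 t)
      (Cardinal.mk_image_le.trans_lt (h𝒱.trans_lt hκθ))
    let m := max bs β
    have hm : m < χ := max_lt hbs hβχ
    let F : Set (Set Ordinal.{0}) := {t | t ∈ 𝒱 ∧ Unb t χ} ∪ {q, Ioi m}
    have hχs : ∀ y < χ, ∃ z, y < z ∧ z < χ := by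
      intro y hy
      obtain ⟨z, _, h1, h2⟩ := hunb y hy
      exact ⟨z, h1, h2⟩
    obtain ⟨hEcl, hEunb⟩ := club_inter hθ0 hχ F (by
        refine (Cardinal.mk_union_le _ _).trans_lt (Cardinal.add_lt_of_lt hθ0.le ?_ ?_)
        · exact (Cardinal.mk_le_mk_of_subset fun t ht => ht.1).trans_lt (h𝒱.trans_lt hκθ)
        · refine lt_of_le_of_lt ?_ hθ0
          exact Cardinal.le_aleph0_iff_set_countable.2 (Set.toFinite _).countable)
      (by
        rintro t (⟨ht, _⟩ | rfl | rfl)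
        · intro α hα
          exact hcl t ht α (hα.trans hχo)
        · intro α hα
          exact hq.2.1 α (hα.trans hχo)
        · intro α hα h0 h
          obtain ⟨y, hy, _, h2⟩ := h 0 (pos_iff_ne_zero.2 h0)
          exact lt_trans hy h2)
      (by
        rintro t (⟨_, ht⟩ | rfl | rfl)
        · exact ht
        · exact hunb.mono inter_subset_left
        · intro y hy
          obtain ⟨z, h1, h2⟩ := hχs _ (max_lt hy hm)
          exact ⟨z, lt_of_le_of_lt (le_max_right _ _) h1,
            lt_of_le_of_lt (le_max_left _ _) h1, h2⟩)
    obtain ⟨δ, hδ, h1, h2, h3, h4⟩ := hc k χ hχ _ hEcl hEunb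
    have hmx : ∀ x ∈ c k χ δ, m < x := fun x hx => h1 hx (Ioi m) (by simp [F])
    refine ⟨c k χ δ, ?_, ?_, ?_, h2, h3, ⟨δ, hδ.trans hχo, h4⟩, ?_⟩
    · exact mem_biUnion hχo (mem_biUnion (hδ.trans hχo) ⟨k, rfl⟩)
    · exact fun x hx => h1 hx q (by simp [F])
    · exact fun x hx => lt_of_le_of_lt (le_max_right _ _) (hmx x hx)
    · intro t ht
      by_cases h : Unb t χ
      · exact Or.inl fun x hx => h1 hx t (Or.inl ⟨ht, h⟩)
      · right
        rw [Set.disjoint_left]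
        intro x hx hxt
        have h5 := hb2 t h x hxt
          ((hbs' _ ⟨t, ht, rfl⟩).trans ((le_max_left _ _).trans_lt (hmx x hx)))
        exact absurd ((h4 hx).trans_lt hδ) (not_lt.2 h5)

/-- The conclusion of `homog_lemma` for a family `𝒢`. -/
def HomogProp (o : Ordinal.{0}) (M : Cardinal.{1}) (κ : ℕ → Cardinal.{1})
    (𝒢 : Set (Set Ordinal.{0})) : Prop :=
  ∀ (k : ℕ) (q : Set Ordinal.{0}), QS o M q →
      ∀ 𝒱 : Set (Set Ordinal.{0}), #𝒱 ≤ κ k → (∀ t ∈ 𝒱, ClosedIn t o) → ∀ β < o,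
      ∃ c ∈ 𝒢, c ⊆ q ∧ (∀ x ∈ c, β < x) ∧ κ k ≤ #c ∧ AccClosed c ∧ (∃ δ < o, c ⊆ Iic δ) ∧
        ∀ t ∈ 𝒱, c ⊆ t ∨ Disjoint c t

/-- The poset of sequences of guessed sets. -/
def KK (o : Ordinal.{0}) (a : ℕ → Ordinal.{0}) (κ : ℕ → Cardinal.{1})
    (𝒢 : Set (Set Ordinal.{0})) : Type 1 :=
  {c : ℕ → Set Ordinal.{0} // ∀ k, c k ∈ 𝒢 ∧ AccClosed (c k) ∧ κ k ≤ #(c k) ∧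
    (∀ x ∈ c k, a k < x) ∧ ∃ δ < o, c k ⊆ Iic δ}

namespace KK

variable {o : Ordinal.{0}} {M : Cardinal.{1}} {a : ℕ → Ordinal.{0}} {κ : ℕ → Cardinal.{1}}
  {𝒢 : Set (Set Ordinal.{0})}

/-- The underlying set of ordinals. -/
def set (c : KK o a κ 𝒢) : Set Ordinal.{0} := ⋃ k, c.1 k

/-- The tops of the pieces. -/
def tops (c : KK o a κ 𝒢) : Set Ordinal.{0} := range fun k => sSup (c.1 k)

instance : Preorder (KK o a κ 𝒢) where
  le c d := ∃ b < o, ∀ x ∈ c.set, b < x → x ∈ d.set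
  le_refl c := by
    obtain ⟨δ, hδ, _⟩ := (c.2 0).2.2.2.2
    exact ⟨δ, hδ, fun x hx _ => hx⟩
  le_trans c d e := by
    rintro ⟨b, hb, h⟩ ⟨b', hb', h'⟩
    exact ⟨max b b', max_lt hb hb', fun x hx hlt =>
      h' x (h x hx ((le_max_left _ _).trans_lt hlt)) ((le_max_right _ _).trans_lt hlt)⟩

theorem le_def {c d : KK o a κ 𝒢} : c ≤ d ↔ ∃ b < o, ∀ x ∈ c.set, b < x → x ∈ d.set := Iff.rfl

theorem le_of_subset {c d : KK o a κ 𝒢} (h : c.set ⊆ d.set) : c ≤ d := by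
  obtain ⟨δ, hδ, _⟩ := (c.2 0).2.2.2.2
  exact ⟨δ, hδ, fun x hx _ => h hx⟩

theorem set_sub (c : KK o a κ 𝒢) : c.set ⊆ Iio o := by
  intro x hx
  obtain ⟨k, hk⟩ := mem_iUnion.1 hx
  obtain ⟨δ, hδ, h⟩ := (c.2 k).2.2.2.2
  exact lt_of_le_of_lt (h hk) hδ

theorem fin_bound {c : ℕ → Set Ordinal.{0}} {α : Ordinal.{0}} (h0 : α ≠ 0) (j : ℕ)
    (h : ∀ k < j, ∃ b < α, ∀ x ∈ c k, b < x → α ≤ x) :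
    ∃ b < α, ∀ k < j, ∀ x ∈ c k, b < x → α ≤ x := by
  induction j with
  | zero => exact ⟨0, pos_iff_ne_zero.2 h0, fun k hk => absurd hk (by simp)⟩
  | succ j ih =>
    obtain ⟨b, hb, h1⟩ := ih fun k hk => h k (by omega)
    obtain ⟨b', hb', h2⟩ := h j (by omega)
    refine ⟨max b b', max_lt hb hb', fun k hk x hx hlt => ?_⟩
    rcases Nat.lt_succ_iff_lt_or_eq.1 hk with h | h
    · exact h1 k h x hx ((le_max_left _ _).trans_lt hlt)
    · subst h
      exact h2 x hx ((le_max_right _ _).trans_lt hlt)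

theorem tail (P : Par o M a κ) (c : KK o a κ 𝒢) (j : ℕ) :
    ∃ b < o, ∀ x ∈ c.set, b < x → ∃ k, j ≤ k ∧ x ∈ c.1 k := by
  have ho : o ≠ 0 := ((zero_le).trans_lt (P.a_lt 0)).ne'
  obtain ⟨b, hb, h⟩ := fin_bound (c := c.1) (α := o) ho j (by
    intro k _
    obtain ⟨δ, hδ, h⟩ := (c.2 k).2.2.2.2
    exact ⟨δ, hδ, fun x hx hlt => absurd (h hx) (not_le.2 hlt)⟩)
  refine ⟨b, hb, fun x hx hlt => ?_⟩
  obtain ⟨k, hk⟩ := mem_iUnion.1 hx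
  refine ⟨k, ?_, hk⟩
  by_contra! hkj
  exact absurd (h k hkj x hk hlt) (not_le.2 (c.set_sub hx))

theorem set_QS (P : Par o M a κ) (c : KK o a κ 𝒢) : QS o M c.set := by
  refine ⟨c.set_sub, ?_, ?_⟩
  · intro α hα h0 h
    obtain ⟨K, hK⟩ := P.a_cof α hα
    by_contra hcon
    obtain ⟨b, hb, hb'⟩ := fin_bound (c := c.1) h0 K (by
      intro k _
      by_contra! h'
      exact hcon (mem_iUnion.2 ⟨k, (c.2 k).2.1 α h0 h'⟩))
    obtain ⟨x, hx, h1, h2⟩ := h b hb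
    obtain ⟨k, hk⟩ := mem_iUnion.1 hx
    by_cases hkK : k < K
    · exact absurd (hb' k hkK x hk h1) (not_le.2 h2)
    · have h3 := (c.2 k).2.2.2.1 x hk
      have h4 := P.a_mono (not_lt.1 hkK)
      exact absurd (h2.trans (hK.trans_le h4)) (not_lt.2 h3.le)
  · apply le_antisymm
    · rw [← P.card_o]
      exact Cardinal.mk_le_mk_of_subset c.set_sub
    · apply P.sup
      intro k
      exact (c.2 k).2.2.1.trans (Cardinal.mk_le_mk_of_subset (subset_iUnion _ k))

theorem top_mem (P : Par o M a κ) (c : KK o a κ 𝒢) (k : ℕ) : sSup (c.1 k) ∈ c.1 k := by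
  obtain ⟨δ, hδ, h⟩ := (c.2 k).2.2.2.2
  have hne : (c.1 k).Nonempty := by
    by_contra hne
    rw [not_nonempty_iff_eq_empty] at hne
    have := (c.2 k).2.2.1
    rw [hne] at this
    simp only [Cardinal.mk_emptyCollection] at this
    exact absurd this (not_le.2 ((P.reg k).pos))
  have e : c.1 k ∩ Iic δ = c.1 k := inter_eq_left.2 h
  obtain ⟨x, hx⟩ := hne
  have h0 : sSup (c.1 k) ≠ 0 := by
    have h1 : x ≤ sSup (c.1 k) := le_csSup ⟨δ, h⟩ hx
    have h2 := (c.2 k).2.2.2.1 x hx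
    exact ((zero_le).trans_lt (h2.trans_le h1)).ne'
  have := sSup_mem_closed (E := c.1 k) (χ := δ + 1) (α := δ)
    (fun α _ h0 h => (c.2 k).2.1 α h0 h) (by simp)
  rw [e] at this
  exact this h0

theorem le_top (c : KK o a κ 𝒢) (k : ℕ) {x : Ordinal.{0}} (hx : x ∈ c.1 k) :
    x ≤ sSup (c.1 k) := by
  obtain ⟨δ, hδ, h⟩ := (c.2 k).2.2.2.2
  exact le_csSup ⟨δ, h⟩ hx

theorem tops_sub (P : Par o M a κ) (c : KK o a κ 𝒢) : c.tops ⊆ c.set := by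
  rintro _ ⟨k, rfl⟩
  exact mem_iUnion.2 ⟨k, top_mem P c k⟩

theorem build (P : Par o M a κ) (H : HomogProp o M κ 𝒢) (A : ℕ → Set Ordinal.{0})
    (hA : ∀ k, QS o M (A k)) (𝒱 : ℕ → Set (Set Ordinal.{0})) (h𝒱 : ∀ k, #(𝒱 k) ≤ κ k)
    (hcl : ∀ k, ∀ t ∈ 𝒱 k, ClosedIn t o) :
    ∃ c : KK o a κ 𝒢, ∀ k, c.1 k ⊆ A k ∧ ∀ t ∈ 𝒱 k, c.1 k ⊆ t ∨ Disjoint (c.1 k) t := by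
  choose c hc1 hc2 hc3 hc4 hc5 hc6 hc7 using
    fun k => H k (A k) (hA k) (𝒱 k) (h𝒱 k) (hcl k) (a k) (P.a_lt k)
  exact ⟨⟨c, fun k => ⟨hc1 k, hc5 k, hc4 k, hc3 k, hc6 k⟩⟩, fun k => ⟨hc2 k, hc7 k⟩⟩

theorem build' (P : Par o M a κ) (H : HomogProp o M κ 𝒢) (A : Set Ordinal.{0})
    (hA : QS o M A) : ∃ c : KK o a κ 𝒢, c.set ⊆ A := by
  obtain ⟨c, hc⟩ := build P H (fun _ => A) (fun _ => hA) (fun _ => ∅) (by simp) (by simp)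
  exact ⟨c, iUnion_subset fun k => (hc k).1⟩

theorem QS_of_tail (P : Par o M a κ) {A B : Set Ordinal.{0}} (hA : QS o M A) {b : Ordinal.{0}}
    (hb : b < o) (hAB : A ∩ Ioi b ⊆ B) (hB : B ⊆ Iio o) (hcl : ClosedIn B o) : QS o M B := by
  refine ⟨hB, hcl, le_antisymm ?_ ?_⟩
  · rw [← P.card_o]
    exact Cardinal.mk_le_mk_of_subset hB
  · apply P.sup
    intro k
    exact (QS_tail P hA.2.2 hb (P.lt k)).le.trans (Cardinal.mk_le_mk_of_subset hAB)

theorem sigma (P : Par o M a κ) (H : HomogProp o M κ 𝒢) : SigmaClosed (KK o a κ 𝒢) := by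
  intro c hc
  have hle : ∀ k j, j ≤ k → c k ≤ c j := by
    intro k
    induction k with
    | zero => intro j hj; rw [Nat.le_zero.1 hj]
    | succ k ih =>
      intro j hj
      rcases Nat.le_succ_iff.1 hj with h | h
      · exact (hc k).trans (ih j h)
      · rw [h]
  let A : ℕ → Set Ordinal.{0} := fun k => {x | ∀ j ≤ k, x ∈ (c j).set}
  have hA : ∀ k, QS o M (A k) := by
    intro k
    have hb : ∃ b < o, (c k).set ∩ Ioi b ⊆ A k := by
      have ho : o ≠ 0 := ((zero_le).trans_lt (P.a_lt 0)).ne'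
      obtain ⟨b, hb, h⟩ := fin_bound (c := fun j => {x | x ∈ (c k).set ∧ x ∉ (c j).set})
        (α := o) ho (k + 1) (by
          intro j hj
          obtain ⟨b, hb, h⟩ := hle k j (by omega)
          exact ⟨b, hb, fun x hx hlt => absurd (h x hx.1 hlt) hx.2⟩)
      refine ⟨b, hb, fun x hx j hj => ?_⟩
      by_contra hxj
      exact absurd (h j (by omega) x ⟨hx.1, hxj⟩ hx.2) (not_le.2 ((c k).set_sub hx.1))
    obtain ⟨b, hb, hsub⟩ := hb
    refine QS_of_tail P (set_QS P (c k)) hb hsub (fun x hx => (c k).set_sub (hx k le_rfl)) ?_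
    intro α hα h0 h j hj
    exact (set_QS P (c j)).2.1 α hα h0 (h.mono fun x hx => hx j hj)
  obtain ⟨d, hd⟩ := build P H A hA (fun _ => ∅) (by simp) (by simp)
  refine ⟨d, fun n => ?_⟩
  obtain ⟨b, hb, h⟩ := tail P d n
  refine ⟨b, hb, fun x hx hlt => ?_⟩
  obtain ⟨k, hk, hxk⟩ := h x hx hlt
  exact (hd k).1 hxk n hk

theorem exists_mem_gt (P : Par o M a κ) (c : KK o a κ 𝒢) {b : Ordinal.{0}} (hb : b < o) :
    ∃ x ∈ c.set, b < x := by
  have h := QS_tail P (set_QS P c).2.2 hb (c := 0) (Cardinal.aleph0_pos.trans_le P.M_inf)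
  obtain ⟨x, hx⟩ := Cardinal.mk_ne_zero_iff.1 h.ne'
  exact ⟨x, hx.1, hx.2⟩

theorem card_le (h𝒢 : #𝒢 ≤ M) : #(KK o a κ 𝒢) ≤ M ^ ℵ₀ := by
  have h1 : #(KK o a κ 𝒢) ≤ #(ℕ → 𝒢) := by
    refine ⟨⟨fun c k => ⟨c.1 k, (c.2 k).1⟩, ?_⟩⟩
    intro c d h
    apply Subtype.ext
    funext k
    exact congrArg Subtype.val (congrFun h k)
  refine h1.trans ?_
  have : #(ℕ → 𝒢) = #𝒢 ^ ℵ₀ := by simp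
  rw [this]
  exact Cardinal.power_le_power_right h𝒢

end KK

/-- A maximal antichain inside `O`. -/
def maxA {K : Type 1} [Preorder K] (O : Set K) : Set K :=
  (max_antichain O ∅ (empty_subset _) (by intro a ha; exact absurd ha (by simp))).choose

theorem maxA_spec {K : Type 1} [Preorder K] (O : Set K) :
    maxA O ⊆ O ∧ Anti (maxA O) ∧ ∀ d ∈ O, ∃ b ∈ maxA O, Cmp d b :=
  (max_antichain O ∅ (empty_subset _) (by intro a ha; exact absurd ha (by simp))).choose_spec.2

section matrix

variable {o : Ordinal.{0}} {M : Cardinal.{1}} {a : ℕ → Ordinal.{0}} {κ : ℕ → Cardinal.{1}}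
  {𝒢 : Set (Set Ordinal.{0})}

/-- The matrix of antichains. -/
def matT (o : Ordinal.{0}) (a : ℕ → Ordinal.{0}) (κ : ℕ → Cardinal.{1})
    (𝒢 : Set (Set Ordinal.{0})) (i : Ordinal.{0}) : Set (KK o a κ 𝒢) :=
  maxA {t | (∀ j, (_ : j < i) → ∃ t' ∈ matT o a κ 𝒢 j, t ≤ t') ∧
    ∀ x ∈ t.set, ∃ s ∈ t.tops, x ≤ s ∧ ∀ j, (_ : j < i) → ∀ t' ∈ matT o a κ 𝒢 j, t ≤ t' →
      ∀ s' ∈ t'.tops, ¬ (x ≤ s' ∧ s' ≤ s)}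
termination_by i

/-- The dense set used at level `i`. -/
def matO (o : Ordinal.{0}) (a : ℕ → Ordinal.{0}) (κ : ℕ → Cardinal.{1})
    (𝒢 : Set (Set Ordinal.{0})) (i : Ordinal.{0}) : Set (KK o a κ 𝒢) :=
  {t | (∀ j, j < i → ∃ t' ∈ matT o a κ 𝒢 j, t ≤ t') ∧
    ∀ x ∈ t.set, ∃ s ∈ t.tops, x ≤ s ∧ ∀ j, j < i → ∀ t' ∈ matT o a κ 𝒢 j, t ≤ t' →
      ∀ s' ∈ t'.tops, ¬ (x ≤ s' ∧ s' ≤ s)}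

theorem matT_eq (i : Ordinal.{0}) : matT o a κ 𝒢 i = maxA (matO o a κ 𝒢 i) := by
  rw [matT]; rfl

theorem matT_anti (i : Ordinal.{0}) : Anti (matT o a κ 𝒢 i) := by
  rw [matT_eq]; exact (maxA_spec _).2.1

theorem matT_sub (i : Ordinal.{0}) : matT o a κ 𝒢 i ⊆ matO o a κ 𝒢 i := by
  rw [matT_eq]; exact (maxA_spec _).1

theorem matO_dense (P : Par o M a κ) (H : HomogProp o M κ 𝒢) (i : Ordinal.{0}) (hi : i < W1)
    (hmax : ∀ j < i, ∀ q, ∃ t ∈ matT o a κ 𝒢 j, Cmp q t) (q : KK o a κ 𝒢) :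
    ∃ r ≤ q, r ∈ matO o a κ 𝒢 i := by
  obtain ⟨r, hrq, hr⟩ := dense_inter (KK.sigma P H) (Iio i) (W1_countable hi)
    (fun j => {r | ∃ t ∈ matT o a κ 𝒢 j, r ≤ t})
    (by
      rintro j _ x y hxy ⟨t, ht, hle⟩
      exact ⟨t, ht, hxy.trans hle⟩)
    (by
      intro j hj q
      obtain ⟨t, ht, r, h1, h2⟩ := hmax j hj q
      exact ⟨r, h1, t, ht, h2⟩) q
  have hne : Nonempty (KK o a κ 𝒢) := ⟨q⟩
  choose! t ht hrt using hr
  let S : Set Ordinal.{0} := ⋃ j ∈ Iio i, (t j).tops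
  have hS : S.Countable := (W1_countable hi).biUnion fun j _ => countable_range _
  let 𝒱 : Set (Set Ordinal.{0}) := (fun s => Iic s) '' S ∪ (fun s => {s}) '' S
  have h𝒱 : 𝒱.Countable := (hS.image _).union (hS.image _)
  obtain ⟨c, hc⟩ := KK.build P H (fun _ => r.set) (fun _ => KK.set_QS P r) (fun _ => 𝒱)
    (fun k => (Cardinal.le_aleph0_iff_set_countable.2 h𝒱).trans (P.reg k).aleph0_le)
    (by
      rintro k t (⟨s, _, rfl⟩ | ⟨s, _, rfl⟩) α hα h0 h
      · by_contra hcon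
        obtain ⟨x, hx, h1, _⟩ := h s (not_le.1 hcon)
        exact absurd hx (not_le.2 h1)
      · exfalso
        obtain ⟨x, hx, h1, h2⟩ := h 0 (pos_iff_ne_zero.2 h0)
        obtain ⟨y, hy, h3, h4⟩ := h x h2
        rw [mem_singleton_iff.1 hx, mem_singleton_iff.1 hy] at h3
        exact lt_irrefl _ h3)
  have hcr : c ≤ r := KK.le_of_subset (iUnion_subset fun k => (hc k).1)
  refine ⟨c, hcr.trans hrq, fun j hj => ⟨t j, ht j hj, hcr.trans (hrt j hj)⟩, ?_⟩
  intro x hx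
  obtain ⟨k, hk⟩ := mem_iUnion.1 hx
  refine ⟨_, ⟨k, rfl⟩, c.le_top k hk, ?_⟩
  rintro j hj t' ht' hct' s' hs' ⟨h1, h2⟩
  have e : t' = t j := matT_anti j _ ht' _ (ht j hj) ⟨c, hct', hcr.trans (hrt j hj)⟩
  subst e
  have hsS : s' ∈ S := mem_biUnion hj hs'
  have htop := KK.top_mem P c k
  have hle : sSup (c.1 k) ≤ s' := by
    rcases (hc k).2 (Iic s') (Or.inl ⟨s', hsS, rfl⟩) with h | h
    · exact h htop
    · exact absurd h1 (Set.disjoint_left.1 h hk)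
  have hmem : s' ∈ c.1 k := by
    rw [le_antisymm h2 hle]; exact htop
  rcases (hc k).2 {s'} (Or.inr ⟨s', hsS, rfl⟩) with h | h
  · have h3 := (c.2 k).2.2.1.trans (Cardinal.mk_le_mk_of_subset h)
    rw [Cardinal.mk_singleton] at h3
    exact absurd h3 (not_le.2 (Cardinal.one_lt_aleph0.trans_le (P.reg k).aleph0_le))
  · exact Set.disjoint_left.1 h hmem rfl

theorem matT_max (P : Par o M a κ) (H : HomogProp o M κ 𝒢) (i : Ordinal.{0}) (hi : i < W1)
    (q : KK o a κ 𝒢) : ∃ t ∈ matT o a κ 𝒢 i, Cmp q t := by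
  induction i using WellFoundedLT.induction generalizing q with
  | ind i ih =>
    obtain ⟨r, hr, hO⟩ := matO_dense P H i hi (fun j hj q => ih j hj (hj.trans hi) q) q
    rw [matT_eq]
    obtain ⟨t, ht, hc⟩ := (maxA_spec _).2.2 r hO
    exact ⟨t, ht, hc.mono hr le_rfl⟩

end matrix

section big

variable {o : Ordinal.{0}} {M : Cardinal.{1}} {a : ℕ → Ordinal.{0}} {κ : ℕ → Cardinal.{1}}
  {𝒢 : Set (Set Ordinal.{0})}

/-- All tops of matrix elements above `d`. -/
def topsAbove (d : KK o a κ 𝒢) : Set Ordinal.{0} :=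
  {s | ∃ i < W1, ∃ t ∈ matT o a κ 𝒢 i, d ≤ t ∧ s ∈ t.tops}

theorem topsAbove_mono {d d' : KK o a κ 𝒢} (h : d' ≤ d) : topsAbove d ⊆ topsAbove d' := by
  rintro s ⟨i, hi, t, ht, hd, hs⟩
  exact ⟨i, hi, t, ht, h.trans hd, hs⟩

/-- The first top above `x`, or `o`. -/
def gam (d : KK o a κ 𝒢) (x : Ordinal.{0}) : Ordinal.{0} := sInf ((topsAbove d ∩ Ici x) ∪ {o})

theorem gam_mono {d d' : KK o a κ 𝒢} (h : d' ≤ d) (x : Ordinal.{0}) : gam d' x ≤ gam d x := by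
  apply csInf_le_csInf (OrderBot.bddBelow _) ⟨o, Or.inr rfl⟩
  exact union_subset_union_left _ (inter_subset_inter_left _ (topsAbove_mono h))

theorem gam_mem (d : KK o a κ 𝒢) (x : Ordinal.{0}) : gam d x ∈ (topsAbove d ∩ Ici x) ∪ {o} :=
  csInf_mem ⟨o, Or.inr rfl⟩

theorem gam_le {d : KK o a κ 𝒢} {x s : Ordinal.{0}} (hs : s ∈ topsAbove d) (hx : x ≤ s) :
    gam d x ≤ s :=
  csInf_le (OrderBot.bddBelow _) (Or.inl ⟨hs, hx⟩)

theorem matT_big (P : Par o M a κ) (H : HomogProp o M κ 𝒢) (q : KK o a κ 𝒢) :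
    ∃ i < W1, M < #{t | t ∈ matT o a κ 𝒢 i ∧ Cmp q t} := by
  by_contra! hcon
  let Tq : Set (KK o a κ 𝒢) := ⋃ i ∈ Iio W1, {t | t ∈ matT o a κ 𝒢 i ∧ Cmp q t}
  have hTq : #Tq ≤ #(Iio o) := by
    rw [P.card_o]
    exact card_biUnion_le P.M_inf _ _ (by rw [W1_card]; exact P.M_unc) (fun i hi => hcon i hi)
  obtain ⟨f⟩ := hTq
  let 𝒱 : ℕ → Set (Set Ordinal.{0}) := fun k =>
    (fun t : Tq => t.1.set) '' {t | (f t).1 < a k}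
  have h𝒱 : ∀ k, #(𝒱 k) ≤ κ k := by
    intro k
    refine Cardinal.mk_image_le.trans (le_trans ?_ (P.ini k))
    refine ⟨⟨fun t => ⟨(f t.1).1, t.2⟩, ?_⟩⟩
    intro t t' h
    apply Subtype.ext
    apply f.injective
    apply Subtype.ext
    exact congrArg (fun z : Iio (a k) => z.1) h
  obtain ⟨c, hc⟩ := KK.build P H (fun _ => q.set) (fun _ => KK.set_QS P q) 𝒱 h𝒱 (by
    rintro k _ ⟨t, _, rfl⟩
    exact (KK.set_QS P t.1).2.1)
  have hcq : c ≤ q := KK.le_of_subset (iUnion_subset fun k => (hc k).1)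
  obtain ⟨d, hdc, hd⟩ := dense_inter_nat (KK.sigma P H)
    (fun k => {d : KK o a κ 𝒢 | ∀ d' ≤ d, gam d' (sSup (c.1 k)) = gam d (sSup (c.1 k))})
    (by
      intro k x y hxy hy d' hd'
      rw [hy d' (hd'.trans hxy), hy x hxy])
    (by
      intro k q
      obtain ⟨r, hr, hmin⟩ := (wellFounded_lt : WellFounded ((· < ·) : Ordinal.{0} → _ → Prop)).has_min
        ((fun d => gam d (sSup (c.1 k))) '' {d : KK o a κ 𝒢 | d ≤ q}) ⟨_, q, le_refl q, rfl⟩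
      obtain ⟨d, hd, rfl⟩ := hr
      refine ⟨d, hd, fun d' hd' => le_antisymm (gam_mono hd' _) ?_⟩
      exact not_lt.1 (hmin _ ⟨d', hd'.trans hd, rfl⟩)) c
  have hwit : ∀ k, ∃ i < W1, gam d (sSup (c.1 k)) < o → ∃ t ∈ matT o a κ 𝒢 i, d ≤ t ∧
      gam d (sSup (c.1 k)) ∈ t.tops ∧ sSup (c.1 k) ≤ gam d (sSup (c.1 k)) := by
    intro k
    rcases gam_mem d (sSup (c.1 k)) with ⟨⟨i, hi, t, ht, hdt, hs⟩, hx⟩ | h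
    · exact ⟨i, hi, fun _ => ⟨t, ht, hdt, hs, hx⟩⟩
    · exact ⟨0, W1_pos, fun h' => absurd h' (by rw [mem_singleton_iff.1 h]; exact lt_irrefl _)⟩
  choose i hi hit using hwit
  have hI : (⨆ k, i k) + 1 < W1 := W1_succ (W1_sup i hi)
  have hlt : ∀ k, i k < (⨆ k, i k) + 1 := fun k =>
    lt_of_le_of_lt (Ordinal.le_iSup i k) (by simp)
  obtain ⟨t, ht, d', hd'd, hd't⟩ := matT_max P H _ hI d
  have htq : t ∈ Tq := mem_biUnion hI ⟨ht, d', (hd'd.trans hdc).trans hcq, hd't⟩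
  obtain ⟨K, hK⟩ := P.a_cof _ (f ⟨t, htq⟩).2
  obtain ⟨b1, hb1, h1⟩ := hd'd.trans hdc
  obtain ⟨b2, hb2, h2⟩ := hd't
  obtain ⟨b3, hb3, h3⟩ := KK.tail P c K
  obtain ⟨x, hx, hxb⟩ := KK.exists_mem_gt P d' (max_lt hb1 (max_lt hb2 hb3))
  simp only [max_lt_iff] at hxb
  obtain ⟨k, hKk, hxk⟩ := h3 x (h1 x hx hxb.1) hxb.2.2
  have hxt := h2 x hx hxb.2.1
  have hsub : c.1 k ⊆ t.set := by
    rcases (hc k).2 t.set ⟨⟨t, htq⟩, hK.trans_le (P.a_mono hKk), rfl⟩ with h | h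
    · exact h
    · exact absurd hxt (Set.disjoint_left.1 h hxk)
  have htO := matT_sub _ ht
  obtain ⟨s, hs, hxs, hno⟩ := htO.2 _ (hsub (KK.top_mem P c k))
  have hg : gam d (sSup (c.1 k)) ≤ s := by
    rw [← hd k d' hd'd]
    exact gam_le ⟨_, hI, t, ht, ⟨b2, hb2, h2⟩, hs⟩ hxs
  have hso : s < o := t.set_sub (KK.tops_sub P t hs)
  obtain ⟨t', ht', hdt', hs', hx'⟩ := hit k (hg.trans_lt hso)
  obtain ⟨t'', ht'', htt''⟩ := htO.1 (i k) (hlt k)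
  have e : t'' = t' := matT_anti _ _ ht'' _ ht'
    ⟨d', le_trans ⟨b2, hb2, h2⟩ htt'', hd'd.trans hdt'⟩
  subst e
  exact hno _ (hlt k) t'' ht' htt'' _ hs' ⟨hx', hg⟩

theorem matT_base (P : Par o M a κ) (H : HomogProp o M κ 𝒢) :
    BaseMatrix (KK o a κ 𝒢) M (matT o a κ 𝒢) where
  anti i _ := matT_anti i
  max i hi q := matT_max P H i hi q
  ref i _ j hj _ ht := (matT_sub i ht).1 j hj
  big q := matT_big P H q

end big

/-- Accumulation points of `p` below `o`. -/
def accO (o : Ordinal.{0}) (p : Set Ordinal.{0}) : Set Ordinal.{0} := {α | α < o ∧ α ≠ 0 ∧ Unb p α}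

section proj

variable {o : Ordinal.{0}} {M : Cardinal.{1}} {a : ℕ → Ordinal.{0}} {κ : ℕ → Cardinal.{1}}
  {𝒢 : Set (Set Ordinal.{0})}

theorem accO_mono {p p' : Set Ordinal.{0}} (h : p ⊆ p') : accO o p ⊆ accO o p' :=
  fun _ hα => ⟨hα.1, hα.2.1, hα.2.2.mono h⟩

theorem accO_closed (p : Set Ordinal.{0}) : ClosedIn (accO o p) o := by
  intro α hα h0 h
  refine ⟨hα, h0, fun b hb => ?_⟩
  obtain ⟨β, hβ, h1, h2⟩ := h b hb
  obtain ⟨x, hx, h3, h4⟩ := hβ.2.2 b h1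
  exact ⟨x, hx, h3, h4.trans h2⟩

theorem accO_QS (P : Par o M a κ) {p : Set Ordinal.{0}} (hp : p ⊆ Iio o) (hc : #p = M) :
    QS o M (accO o p) := by
  have hsub : accO o p ⊆ Iio o := fun α hα => hα.1
  refine ⟨hsub, accO_closed p, le_antisymm ?_ ?_⟩
  · rw [← P.card_o]; exact Cardinal.mk_le_mk_of_subset hsub
  apply P.sup
  intro k
  by_contra! hlt
  obtain ⟨χ, hCG, hU, _, x, hx, hχx⟩ := first_lemma (P.reg k) hp (by rw [hc]; exact P.lt k)
  have hχo : χ < o := lt_of_le_of_lt hχx (hp hx)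
  obtain ⟨b, hb, hbd⟩ := hCG (accO o p ∩ Iio χ) inter_subset_right
    ((Cardinal.mk_le_mk_of_subset inter_subset_left).trans_lt hlt)
  have hstep : ∀ y : Iio χ, ∃ z : Iio χ, z.1 ∈ p ∧ y.1 < z.1 := by
    intro y
    obtain ⟨z, hz, h1, h2⟩ := hU y.1 y.2
    exact ⟨⟨z, h2⟩, hz, h1⟩
  choose g hg1 hg2 using hstep
  let u : ℕ → Iio χ := fun n => Nat.rec ⟨b, hb⟩ (fun _ r => g r) n
  have hu1 : ∀ n, (u (n + 1)).1 ∈ p := fun n => hg1 (u n)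
  have hu2 : ∀ n, (u n).1 < (u (n + 1)).1 := fun n => hg2 (u n)
  obtain ⟨b', hb', hbd'⟩ := hCG (range fun n => (u n).1)
    (by rintro _ ⟨n, rfl⟩; exact (u n).2)
    (lt_of_le_of_lt (Cardinal.le_aleph0_iff_set_countable.2 (countable_range _))
      ((Cardinal.aleph0_lt_aleph_one).trans_le (P.unc k)))
  have hle : ∀ n, (u n).1 ≤ ⨆ n, (u n).1 := fun n => Ordinal.le_iSup (fun n => (u n).1) n
  have hαχ : (⨆ n, (u n).1) < χ :=
    lt_of_le_of_lt (Ordinal.iSup_le fun n => (hbd' _ ⟨n, rfl⟩).le) hb'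
  have hbα : b < ⨆ n, (u n).1 := (hu2 0).trans_le (hle 1)
  have hmem : (⨆ n, (u n).1) ∈ accO o p := by
    refine ⟨hαχ.trans hχo, ((zero_le).trans_lt hbα).ne', fun c hc => ?_⟩
    obtain ⟨n, hn⟩ := Ordinal.lt_iSup_iff.1 hc
    exact ⟨_, hu1 n, hn.trans (hu2 n), (hu2 (n + 1)).trans_le (hle (n + 2))⟩
  exact absurd (hbd _ ⟨hmem, hαχ⟩) (not_lt.2 hbα.le)

theorem tail_QS (P : Par o M a κ) {A : Set Ordinal.{0}} (hA : QS o M A) {b : Ordinal.{0}}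
    (hb : b < o) : QS o M (A ∩ Ioi b) := by
  refine KK.QS_of_tail P hA hb subset_rfl (inter_subset_left.trans hA.1) ?_
  intro α hα h0 h
  refine ⟨hA.2.1 α hα h0 (h.mono inter_subset_left), ?_⟩
  obtain ⟨x, hx, h1, h2⟩ := h 0 (pos_iff_ne_zero.2 h0)
  exact lt_trans hx.2 h2

theorem thin (P : Par o M a κ) {p D : Set Ordinal.{0}} (hD : QS o M D) (hDp : D ⊆ accO o p) :
    ∃ p' ⊆ p, #p' = M ∧ accO o p' ⊆ D := by
  have hne : ∀ α ∈ D, (D ∩ Ioi α).Nonempty := by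
    intro α hα
    have h := QS_tail P hD.2.2 (hD.1 hα) (c := 0) (Cardinal.aleph0_pos.trans_le P.M_inf)
    obtain ⟨x, hx⟩ := Cardinal.mk_ne_zero_iff.1 h.ne'
    exact ⟨x, hx⟩
  have hy : ∀ α : D, ∃ y ∈ p, α.1 < y ∧ ∀ β ∈ D, α.1 < β → y < β := by
    rintro ⟨α, hα⟩
    have hm := csInf_mem (hne α hα)
    obtain ⟨y, hy, h1, h2⟩ := (hDp hm.1).2.2 α hm.2
    exact ⟨y, hy, h1, fun β hβ hlt => h2.trans_le (csInf_le (OrderBot.bddBelow _) ⟨hβ, hlt⟩)⟩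
  choose y hyp hy1 hy2 using hy
  have hmono : StrictMono y := fun α β h => (hy2 α β.1 β.2 h).trans (hy1 β)
  refine ⟨range y, by rintro _ ⟨α, rfl⟩; exact hyp α, ?_, ?_⟩
  · rw [Cardinal.mk_range_eq _ hmono.injective, hD.2.2]
  · rintro α ⟨hα, h0, h⟩
    refine hD.2.1 α hα h0 fun b hb => ?_
    obtain ⟨_, ⟨β, rfl⟩, h1, h2⟩ := h b hb
    obtain ⟨_, ⟨γ, rfl⟩, h3, h4⟩ := h _ h2
    have hβγ : β < γ := hmono.lt_iff_lt.1 h3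
    exact ⟨γ.1, γ.2, h1.trans (hy2 β γ.1 γ.2 hβγ), (hy1 γ).trans h4⟩

end proj

theorem projection {μ : Cardinal.{0}} {a : ℕ → Ordinal.{0}} {κ : ℕ → Cardinal.{1}}
    {𝒢 : Set (Set Ordinal.{0})}
    (P : Par μ.ord (Cardinal.lift.{1} μ) a κ) (H : HomogProp μ.ord (Cardinal.lift.{1} μ) κ 𝒢)
    (B : Type 1) [CompleteBooleanAlgebra B]
    (e : {p : Set Ordinal.{0} // InP μ p} → B)
    (he₁ : ∀ p, e p ≠ ⊥)
    (he₂ : ∀ p q, condLe μ p.1 q.1 → e p ≤ e q)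
    (he₃ : ∀ p q, (∃ r : {p : Set Ordinal.{0} // InP μ p},
        condLe μ r.1 p.1 ∧ condLe μ r.1 q.1) ↔ e p ⊓ e q ≠ ⊥)
    (he₄ : ∀ b : B, b ≠ ⊥ → ∃ p, e p ≤ b) :
    ∃ E : KK μ.ord a κ 𝒢 → B, (∀ d d', ¬ Cmp d d' → E d ⊓ E d' = ⊥) ∧ (∀ d, E d ≠ ⊥) ∧
      ∀ b, b ≠ ⊥ → ∃ d, ∀ d' ≤ d, E d' ⊓ b ≠ ⊥ := by
  have hM0 : (0 : Cardinal.{1}) < Cardinal.lift.{1} μ := Cardinal.aleph0_pos.trans_le P.M_inf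
  let R : KK μ.ord a κ 𝒢 → Set {p : Set Ordinal.{0} // InP μ p} := fun d =>
    {p | ∃ b < μ.ord, ∀ x ∈ accO μ.ord p.1, b < x → x ∈ d.set}
  have hE : ∀ d p, p ∈ R d → e p ≤ sSup (e '' R d) := fun d p hp => le_sSup ⟨p, hp, rfl⟩
  refine ⟨fun d => sSup (e '' R d), ?_, ?_, ?_⟩
  · intro d d' hdd
    rw [← disjoint_iff, sSup_disjoint_iff]
    rintro _ ⟨p, ⟨b, hb, hp⟩, rfl⟩
    rw [disjoint_sSup_iff]
    rintro _ ⟨p', ⟨b', hb', hp'⟩, rfl⟩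
    rw [disjoint_iff]
    by_contra hne
    obtain ⟨r, hr, hr'⟩ := (he₃ p p').2 hne
    have hcard : #(r.1 ∩ (p.1 ∩ p'.1) : Set Ordinal.{0}) = Cardinal.lift.{1} μ := by
      apply le_antisymm
      · rw [← show #r.1 = Cardinal.lift.{1} μ from r.2.2]
        exact Cardinal.mk_le_mk_of_subset inter_subset_left
      · by_contra! hlt
        have hs : r.1 ⊆ (r.1 ∩ (p.1 ∩ p'.1)) ∪ ((r.1 \ p.1) ∪ (r.1 \ p'.1)) := by
          intro x hx
          by_cases h1 : x ∈ p.1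
          · by_cases h2 : x ∈ p'.1
            · exact Or.inl ⟨hx, h1, h2⟩
            · exact Or.inr (Or.inr ⟨hx, h2⟩)
          · exact Or.inr (Or.inl ⟨hx, h1⟩)
        have h1 := (Cardinal.mk_le_mk_of_subset hs).trans (Cardinal.mk_union_le _ _)
        have h2 : #(r.1 \ p.1 ∪ r.1 \ p'.1 : Set Ordinal.{0}) < Cardinal.lift.{1} μ :=
          (Cardinal.mk_union_le _ _).trans_lt (Cardinal.add_lt_of_lt P.M_inf hr hr')
        have h3 := h1.trans_lt (Cardinal.add_lt_of_lt P.M_inf hlt h2)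
        rw [show #r.1 = Cardinal.lift.{1} μ from r.2.2] at h3
        exact lt_irrefl _ h3
    have hQ := tail_QS P (accO_QS P (inter_subset_left.trans r.2.1) hcard) (max_lt hb hb')
    obtain ⟨c, hc⟩ := KK.build' P H _ hQ
    refine hdd ⟨c, KK.le_of_subset fun x hx => ?_, KK.le_of_subset fun x hx => ?_⟩
    · have := hc hx
      exact hp x (accO_mono (fun y hy => hy.2.1) this.1) ((le_max_left _ _).trans_lt this.2)
    · have := hc hx
      exact hp' x (accO_mono (fun y hy => hy.2.2) this.1) ((le_max_right _ _).trans_lt this.2)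
  · intro d hbot
    have hQ := KK.set_QS P d
    let p : {p : Set Ordinal.{0} // InP μ p} := ⟨d.set, hQ.1, hQ.2.2⟩
    have := hE d p ⟨a 0, P.a_lt 0, fun x hx _ => hQ.2.1 x hx.1 hx.2.1 hx.2.2⟩
    replace this := this.trans_eq hbot
    exact he₁ p (le_bot_iff.1 this)
  · intro b hb
    obtain ⟨p, hp⟩ := he₄ b hb
    obtain ⟨d, hd⟩ := KK.build' P H _ (accO_QS P p.2.1 p.2.2)
    refine ⟨d, fun d' hd' => ?_⟩
    obtain ⟨b0, hb0, h0⟩ := hd'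
    obtain ⟨p', hp'p, hc, hacc⟩ := thin P (p := p.1) (tail_QS P (KK.set_QS P d') hb0)
      (fun x hx => hd (h0 x hx.1 hx.2))
    let p1 : {p : Set Ordinal.{0} // InP μ p} := ⟨p', hp'p.trans p.2.1, hc⟩
    have h1 : e p1 ≤ e p := by
      apply he₂
      show #(p' \ p.1 : Set Ordinal.{0}) < _
      rw [sdiff_eq_empty.2 hp'p]
      simpa using hM0
    have h2 := hE d' p1 ⟨b0, hb0, fun x hx _ => (hacc hx).1⟩
    intro hbot
    have := le_inf h2 (h1.trans hp)
    rw [hbot] at this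
    exact he₁ p1 (le_bot_iff.1 this)

theorem par_exists (μ : Cardinal.{0}) (hinf : Cardinal.aleph0 < μ)
    (hcof : μ.ord.cof = Cardinal.aleph0) :
    ∃ a κ, Par μ.ord (Cardinal.lift.{1} μ) a κ := by
  have hlim : ∀ c < μ, Order.succ c < μ := by
    intro c hc
    refine lt_of_le_of_ne (Order.succ_le_of_lt hc) fun h => ?_
    have hc0 : ℵ₀ ≤ c := by
      by_contra! h'
      have : Order.succ c ≤ ℵ₀ := Order.succ_le_of_lt h'
      rw [h] at this
      exact absurd this (not_le.2 hinf)
    have hr := (Cardinal.isRegular_succ hc0).cof_ord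
    rw [h, hcof] at hr
    exact hinf.ne hr
  have hlimL : ∀ c < Cardinal.lift.{1} μ, Order.succ c < Cardinal.lift.{1} μ := by
    intro c hc
    obtain ⟨c', h, rfl⟩ := Cardinal.lt_lift_iff.1 hc
    rw [← Cardinal.lift_succ, Cardinal.lift_lt]
    exact hlim c' h
  have h1 : Cardinal.aleph 1 < μ := by
    rw [← Cardinal.succ_aleph0]; exact hlim _ hinf
  have hu : Cardinal.aleph.{1} 1 < Cardinal.lift.{1} μ := by
    have : Cardinal.aleph.{1} 1 = Cardinal.lift.{1} (Cardinal.aleph.{0} 1) := by simp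
    rw [this, Cardinal.lift_lt]; exact h1
  have hb : ∀ b < μ.ord, #(Iio b) < Cardinal.lift.{1} μ := by
    intro b hb
    rw [Cardinal.mk_Iio_ordinal, Cardinal.lift_lt]
    exact Cardinal.lt_ord.1 hb
  have ha : ∃ a : ℕ → Ordinal.{0}, (∀ k, a k < μ.ord) ∧ Monotone a ∧ ∀ b < μ.ord, ∃ k, b < a k := by
    obtain ⟨s, hs, hsc⟩ := Order.exists_cof_eq (Iio μ.ord)
    rw [Ordinal.cof_Iio, ← Ordinal.lift_cof, hcof, Cardinal.lift_aleph0] at hsc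
    have hcnt : s.Countable := Cardinal.le_aleph0_iff_set_countable.1 hsc.le
    have hne : s.Nonempty := by
      rw [← Set.nonempty_coe_sort, ← Cardinal.mk_ne_zero_iff, hsc]
      exact Cardinal.aleph0_ne_zero
    obtain ⟨g, rfl⟩ := hcnt.exists_eq_range hne
    have hsucc : ∀ b < μ.ord, b + 1 < μ.ord := fun b hb => by
      simpa using (Cardinal.isSuccLimit_ord hinf.le).succ_lt hb
    let u : ℕ → Ordinal.{0} := fun n => Nat.rec ((g 0).1 + 1) (fun n r => max r ((g (n + 1)).1 + 1)) n
    refine ⟨u, fun k => ?_, monotone_nat_of_le_succ fun n => le_max_left _ _, fun b hb => ?_⟩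
    · induction k with
      | zero => exact hsucc _ (g 0).2
      | succ k ih => exact max_lt ih (hsucc _ (g (k + 1)).2)
    · obtain ⟨_, ⟨k, rfl⟩, hk⟩ := hs ⟨b, hb⟩
      refine ⟨k, lt_of_le_of_lt (show b ≤ (g k).1 from hk) ?_⟩
      have h : (g k).1 + 1 ≤ u k := by
        cases k with
        | zero => exact le_rfl
        | succ k => exact le_max_right _ _
      exact lt_of_lt_of_le (by simp) h
  obtain ⟨a, ha1, ha2, ha3⟩ := ha
  have hcard : #(Iio μ.ord) = Cardinal.lift.{1} μ := by
    rw [Cardinal.mk_Iio_ordinal]; simp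
  have hmono : Monotone fun k => Order.succ (max #(Iio (a k)) (Cardinal.aleph 1)) := by
    intro i j hij
    exact Order.succ_le_succ (max_le_max_right _
      (Cardinal.mk_le_mk_of_subset (Iio_subset_Iio (ha2 hij))))
  refine ⟨a, fun k => Order.succ (max #(Iio (a k)) (Cardinal.aleph 1)), ha1, ha2, ha3, ?_, ?_, ?_,
    ?_, hmono, hlimL, ?_, hcard, hb⟩
  · exact fun k => Cardinal.isRegular_succ ((Cardinal.aleph0_le_aleph 1).trans (le_max_right _ _))
  · exact fun k => (le_max_right _ _).trans (Order.le_succ _)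
  · exact fun k => (le_max_left _ _).trans (Order.le_succ _)
  · exact fun k => hlimL _ (max_lt (hb _ (ha1 k)) hu)
  · intro N hN
    by_contra! hlt
    obtain ⟨N', h, rfl⟩ := Cardinal.lt_lift_iff.1 hlt
    obtain ⟨k, hk⟩ := ha3 N'.ord (Cardinal.ord_lt_ord.2 h)
    have h2 := (Order.lt_succ _).trans_le (hN k)
    have h3 := (le_max_left _ _).trans_lt h2
    rw [Cardinal.mk_Iio_ordinal, Cardinal.lift_lt, ← Cardinal.lt_ord] at h3
    exact absurd h3 (not_lt.2 hk.le)

/-- Main Theorem, Kojman–Shelah: the completion of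
`P(μ)/[μ]^{<μ}` (presented as the completion `B` of the poset of size-`μ`
subsets of `μ` ordered by almost-inclusion) contains a complete subalgebra
isomorphic to the completion `C` of `Col(ω₁, μ^{ℵ₀})`. -/
theorem stmt_16 (μ : Cardinal.{0}) (hinf : Cardinal.aleph0 < μ)
    (hcof : μ.ord.cof = Cardinal.aleph0)
    -- `B` is the completion of the quotient algebra: the poset `P` embeds densely
    (B : Type 1) [CompleteBooleanAlgebra B]
    (e : {p : Set Ordinal.{0} // InP μ p} → B)
    (he₁ : ∀ p, e p ≠ ⊥)
    (he₂ : ∀ p q, condLe μ p.1 q.1 → e p ≤ e q)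
    (he₃ : ∀ p q, (∃ r : {p : Set Ordinal.{0} // InP μ p},
        condLe μ r.1 p.1 ∧ condLe μ r.1 q.1) ↔ e p ⊓ e q ≠ ⊥)
    (he₄ : ∀ b : B, b ≠ ⊥ → ∃ p, e p ≤ b)
    -- `C` is the completion of `Col(ω₁, μ^{ℵ₀})`
    (C : Type 1) [CompleteBooleanAlgebra C]
    (e' : Col (μ ^ Cardinal.aleph0) → C)
    (he'₁ : ∀ f, e' f ≠ ⊥)
    (he'₂ : ∀ f g, f ≤ g → e' f ≤ e' g)
    (he'₃ : ∀ f g, (∃ r, r ≤ f ∧ r ≤ g) ↔ e' f ⊓ e' g ≠ ⊥)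
    (he'₄ : ∀ c : C, c ≠ ⊥ → ∃ f, e' f ≤ c) :
    -- then `C` embeds into `B` as a complete subalgebra
    ∃ F : C → B, Function.Injective F ∧ F ⊥ = ⊥ ∧ F ⊤ = ⊤ ∧
      (∀ a b, F (a ⊓ b) = F a ⊓ F b) ∧ (∀ a b, F (a ⊔ b) = F a ⊔ F b) ∧
      (∀ a, F aᶜ = (F a)ᶜ) ∧
      (∀ S : Set C, F (sSup S) = sSup (F '' S)) ∧
      (∀ S : Set C, F (sInf S) = sInf (F '' S)) := by
  obtain ⟨a, κ, P⟩ := par_exists μ hinf hcof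
  obtain ⟨𝒢, h𝒢, H⟩ := homog_lemma P
  have H' : HomogProp μ.ord (Cardinal.lift.{1} μ) κ 𝒢 := H
  obtain ⟨E, E2, E3, E4⟩ := projection P H' B e he₁ he₂ he₃ he₄
  have hQ : QS μ.ord (Cardinal.lift.{1} μ) (Set.Iio μ.ord) :=
    ⟨subset_rfl, fun α hα _ _ => hα, P.card_o⟩
  obtain ⟨c, _⟩ := KK.build' P H' _ hQ
  have : Nonempty (KK μ.ord a κ 𝒢) := ⟨c⟩
  obtain ⟨ι, h1, h2, h3⟩ := collapse_main (KK.sigma P H') P.M_unc (matT_base P H')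
    (μ ^ Cardinal.aleph0) (by simp) (KK.card_le h𝒢) E E2 E3 E4
  exact embed_lemma e' he'₁ he'₂ he'₃ he'₄ ι h1 h2 h3
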